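/- For every integer n ≥ 3 there exist a Ważewski dendrite X of order n and a finitely generated subgroup G of Homeo(X), dense in Homeo(X), such that for all finite sets F₁, F₂ of branch points of X and every homeomorphism ψ from [F₁] onto [F₂] satisfying ψ(F₁) = F₂, there exists g ∈ G with g(p) = ψ(p) for every p ∈ F₁; here [F] denotes the smallest closed connected subset of X containing F. -/

import Mathlib

open Topology

/-- The set of connected components of a subset `S` of `X`. -/
def setComponents (X : Type*) [TopologicalSpace X] (S : Set X) : Set (Set X) :=
  {C | ∃ x ∈ S, C = connectedComponentIn S x}

/-- The order of a point `p` of `X`: the number of connected components of `X \ {p}`. -/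
noncomputable def ptOrder (X : Type*) [TopologicalSpace X] (p : X) : ℕ :=
  (setComponents X {p}ᶜ).ncard

/-- A dendrite: a nonempty, compact, connected, locally connected metrizable space
containing no subspace homeomorphic to the circle. -/
def IsDendrite (X : Type*) [TopologicalSpace X] : Prop :=
  Nonempty X ∧ CompactSpace X ∧ ConnectedSpace X ∧ LocallyConnectedSpace X ∧
    TopologicalSpace.MetrizableSpace X ∧
    ∀ S : Set X, IsEmpty (S ≃ₜ Circle)

/-- A Ważewski dendrite of order `n`: a dendrite all of whose points have order `1`, `2`
or `n`, and every arc (subspace homeomorphic to `[0,1]`) contains a point of order `n`. -/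
def IsWazewskiDendrite (n : ℕ) (X : Type*) [TopologicalSpace X] : Prop :=
  IsDendrite X ∧
  (∀ p : X, ptOrder X p = 1 ∨ ptOrder X p = 2 ∨ ptOrder X p = n) ∧
  ∀ A : Set X, Nonempty (A ≃ₜ unitInterval) → ∃ p ∈ A, ptOrder X p = n

/-- The group structure on self-homeomorphisms of `X`, with composition as product. -/
instance Homeomorph.instGroupSelf (X : Type*) [TopologicalSpace X] : Group (X ≃ₜ X) where
  mul f g := g.trans f
  one := Homeomorph.refl X
  inv := Homeomorph.symm
  mul_assoc _ _ _ := rfl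
  one_mul _ := Homeomorph.ext fun _ => rfl
  mul_one _ := Homeomorph.ext fun _ => rfl
  inv_mul_cancel := Homeomorph.self_trans_symm

/-- The compact-open topology on the group of self-homeomorphisms of `X` (for compact
metric `X`, this is the topology of uniform convergence). -/
instance Homeomorph.instTopSelf (X : Type*) [TopologicalSpace X] :
    TopologicalSpace (X ≃ₜ X) :=
  TopologicalSpace.induced (fun h : X ≃ₜ X => (h : C(X, X))) ContinuousMap.compactOpen

/-- The minimal closed connected subset of `X` containing `F`: the intersection of all
closed (pre)connected subsets containing `F`. -/
def dendriteHull (X : Type*) [TopologicalSpace X] (F : Set X) : Set X :=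
  ⋂₀ {C : Set X | IsClosed C ∧ IsPreconnected C ∧ F ⊆ C}

theorem subset_dendriteHull {X : Type*} [TopologicalSpace X] {F : Set X} {p : X}
    (hp : p ∈ F) : p ∈ dendriteHull X F :=
  Set.mem_sInter.mpr fun _ hC => hC.2.2 hp

/-! ## Abstract tree structures and their completions -/

namespace WD

/-- A countable-tree structure: `δ a b` is the direction at `a` towards `b`. -/
structure TreeStr (D B : Type) where
  δ : B → B → Option D
  none_iff : ∀ a b, δ a b = none ↔ a = b
  tree : ∀ a b p, a ≠ b → δ a p = δ a b ∨ δ b p = δ b a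
  med : ∀ a b c, a ≠ b → a ≠ c → b ≠ c →
    ∃ m, δ m a ≠ δ m b ∧ δ m a ≠ δ m c ∧ δ m b ≠ δ m c
  dense : ∀ a b, a ≠ b → ∃ c, c ≠ a ∧ c ≠ b ∧ δ c a ≠ δ c b
  surj : ∀ b i, ∃ p, δ b p = some i

namespace TreeStr

variable {D B : Type} (T : TreeStr D B)

theorem self (a : B) : T.δ a a = none := (T.none_iff a a).2 rfl

theorem ne_none {a b : B} (h : a ≠ b) : T.δ a b ≠ none := fun h' => h ((T.none_iff a b).1 h')

/-- Lifts of the branch point `b`. -/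
noncomputable def pt (b : B) (o : Option D) : B → Option D :=
  open Classical in fun a => if a = b then o else T.δ a b

@[simp] theorem pt_self (b : B) (o : Option D) : T.pt b o b = o := by simp [pt]

theorem pt_ne {a b : B} (o : Option D) (h : a ≠ b) : T.pt b o a = T.δ a b := by simp [pt, h]

theorem pt_none (b : B) : T.pt b none = fun a => T.δ a b := by
  funext a
  by_cases h : a = b
  · subst h; simp [T.self]
  · rw [T.pt_ne _ h]

/-- The pre-completion (a closed subset of a Cantor-like space). -/
def E : Set (B → Option D) := {x | ∀ a b, a ≠ b → x a = T.δ a b ∨ x b = T.δ b a}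

theorem pt_mem (b : B) (o : Option D) : T.pt b o ∈ T.E := by
  intro a c hac
  by_cases ha : a = b
  · subst ha
    right; rw [T.pt_ne _ hac.symm]
  · by_cases hc : c = b
    · subst hc
      left; rw [T.pt_ne _ ha]
    · rw [T.pt_ne _ ha, T.pt_ne _ hc]
      exact T.tree a c b hac

theorem eq_pt_of_none {e : B → Option D} (he : e ∈ T.E) {b : B} (h : e b = none) :
    e = T.pt b none := by
  funext a
  by_cases hab : a = b
  · subst hab; simp [h]
  · rw [T.pt_ne _ hab]
    rcases he a b hab with h1 | h1
    · exact h1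
    · rw [h] at h1
      exact absurd h1.symm (T.ne_none (Ne.symm hab))

/-- The retraction collapsing all lifts of a branch point. -/
noncomputable def R (e : B → Option D) : B → Option D :=
  open Classical in fun b => if e = T.pt b (e b) then none else e b

theorem R_pt (b : B) (o : Option D) : T.R (T.pt b o) = fun a => T.δ a b := by
  funext a
  by_cases hab : a = b
  · subst hab; simp [R, T.self]
  · have : T.pt b o ≠ T.pt a (T.pt b o a) := by
      intro h
      obtain ⟨c, hca, hcb, hc⟩ := T.dense a b hab
      have := congrFun h c
      rw [T.pt_ne _ hcb, T.pt_ne _ hca] at this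
      exact hc this.symm
    simp only [R, if_neg this]
    rw [T.pt_ne _ hab]

theorem R_eq_or (e : B → Option D) (b : B) : T.R e b = e b ∨ T.R e b = none := by
  unfold R
  split_ifs <;> simp

theorem R_eq_of_none {e : B → Option D} (he : e ∈ T.E) {b : B} (h : T.R e b = none) :
    T.R e = fun a => T.δ a b := by
  have : e = T.pt b (e b) := by
    by_contra hne
    simp only [R, if_neg hne] at h
    rw [h] at hne
    exact hne (T.eq_pt_of_none he h)
  rw [this, R_pt]

theorem R_of_ne_none {e : B → Option D} {b : B} (h : T.R e b ≠ none) : T.R e b = e b := by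
  rcases T.R_eq_or e b with h1 | h1
  · exact h1
  · exact absurd h1 h

/-- The completion. -/
structure X where
  /-- the underlying family of directions -/
  val : B → Option D
  prop : ∃ e ∈ T.E, T.R e = val

theorem X_ext {x y : T.X} (h : x.1 = y.1) : x = y := by
  cases x; cases y; cases h; rfl

/-- Half-spaces. -/
def U (b : B) (o : Option D) : Set T.X := {x | x.1 b = o}

theorem mem_U {b : B} {o : Option D} {x : T.X} : x ∈ T.U b o ↔ x.1 b = o := Iff.rfl

instance : TopologicalSpace T.X :=
  TopologicalSpace.generateFrom {s | ∃ b i, s = T.U b (some i)}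

theorem isOpen_U (b : B) {o : Option D} (ho : o ≠ none) : IsOpen (T.U b o) := by
  obtain ⟨i, rfl⟩ := Option.ne_none_iff_exists'.1 ho
  exact TopologicalSpace.isOpen_generateFrom_of_mem ⟨b, i, rfl⟩

/-- The map from the pre-completion. -/
noncomputable def r (e : T.E) : T.X := ⟨T.R e.1, e.1, e.2, rfl⟩

theorem r_surj : Function.Surjective T.r := by
  rintro ⟨x, e, he, rfl⟩
  exact ⟨⟨e, he⟩, rfl⟩

/-- Branch points. -/
def br (b : B) : T.X := ⟨fun a => T.δ a b, T.pt b none, T.pt_mem b none, T.R_pt b none⟩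

@[simp] theorem br_val (a b : B) : (T.br b).1 a = T.δ a b := rfl

theorem br_inj {a b : B} (h : T.br a = T.br b) : a = b := by
  have := congrArg (fun x => x.1 a) h
  simp only [br_val] at this
  rw [T.self] at this
  exact (T.none_iff _ _).1 this.symm

theorem eq_br_of_none {x : T.X} {b : B} (h : x.1 b = none) : x = T.br b := by
  obtain ⟨x, e, he, rfl⟩ := x
  exact T.X_ext (T.R_eq_of_none he h)

theorem ne_none_of_ne_br {x : T.X} {b : B} (h : x ≠ T.br b) : x.1 b ≠ none :=
  fun h' => h (T.eq_br_of_none h')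

theorem r_pt (b : B) (o : Option D) : T.r ⟨T.pt b o, T.pt_mem b o⟩ = T.br b :=
  T.X_ext (T.R_pt b o)

theorem sep_aux {x y : T.X} {a : B} (hx : x.1 a = none) (hy : y.1 a ≠ none) :
    ∃ b, x.1 b ≠ none ∧ y.1 b ≠ none ∧ x.1 b ≠ y.1 b := by
  obtain rfl := T.eq_br_of_none hx
  obtain ⟨y, e, he, rfl⟩ := y
  have hne : e ≠ T.pt a (e a) := by
    intro h
    apply hy
    simp only [R, if_pos h]
  obtain ⟨p, hp⟩ := Function.ne_iff.1 hne
  have hpa : p ≠ a := by rintro rfl; simp at hp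
  rw [T.pt_ne _ hpa] at hp
  by_cases hyp : T.R e p = none
  · have := T.R_eq_of_none he hyp
    obtain ⟨c, hca, hcp, hc⟩ := T.dense a p hpa.symm
    refine ⟨c, T.ne_none hca, ?_, ?_⟩
    · show T.R e c ≠ none
      rw [this]; exact T.ne_none hcp
    · show T.δ c a ≠ T.R e c
      rw [this]; exact hc
  · refine ⟨p, T.ne_none hpa, hyp, ?_⟩
    show T.δ p a ≠ T.R e p
    rw [T.R_of_ne_none hyp]; exact hp.symm

theorem sep {x y : T.X} (h : x ≠ y) : ∃ b, x.1 b ≠ none ∧ y.1 b ≠ none ∧ x.1 b ≠ y.1 b := by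
  have : x.1 ≠ y.1 := fun h' => h (T.X_ext h')
  obtain ⟨a, ha⟩ := Function.ne_iff.1 this
  by_cases hx : x.1 a = none
  · exact T.sep_aux hx (fun h => ha (hx.trans h.symm))
  · by_cases hy : y.1 a = none
    · obtain ⟨b, h1, h2, h3⟩ := T.sep_aux hy hx
      exact ⟨b, h2, h1, h3.symm⟩
    · exact ⟨a, hx, hy, ha⟩

instance : T2Space T.X := by
  refine ⟨fun x y h => ?_⟩
  obtain ⟨b, h1, h2, h3⟩ := T.sep h
  refine ⟨T.U b (x.1 b), T.U b (y.1 b), T.isOpen_U b h1, T.isOpen_U b h2, rfl, rfl, ?_⟩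
  rw [Set.disjoint_left]
  intro z hz hz'
  exact h3 (hz.symm.trans hz')

section top

local instance optTop : TopologicalSpace (Option D) := ⊥
local instance optDisc : DiscreteTopology (Option D) := ⟨rfl⟩

theorem continuous_r : Continuous T.r := by
  refine continuous_generateFrom_iff.2 ?_
  rintro s ⟨b, i, rfl⟩
  have : T.r ⁻¹' (T.U b (some i)) =
      {e : T.E | e.1 b = some i} ∩ {⟨T.pt b (some i), T.pt_mem _ _⟩}ᶜ := by
    ext e
    constructor
    · intro h
      replace h : T.R e.1 b = some i := h
      have h' : e.1 b = some i := by
        rw [← h]; exact (T.R_of_ne_none (by rw [h]; simp)).symm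
      refine ⟨h', fun h2 => ?_⟩
      have : e.1 = T.pt b (some i) := congrArg Subtype.val h2
      rw [this, R_pt] at h
      simp [T.self] at h
    · rintro ⟨h1, h2⟩
      replace h1 : e.1 b = some i := h1
      show T.R e.1 b = some i
      have : e.1 ≠ T.pt b (e.1 b) := by
        rw [h1]; intro h3; exact h2 (Subtype.ext h3)
      simp only [R, if_neg this]; exact h1
  rw [this]
  refine IsOpen.inter ?_ isOpen_compl_singleton
  have hc : Continuous (fun e : T.E => e.1 b) := (continuous_apply b).comp continuous_subtype_val
  exact hc.isOpen_preimage {some i} (isOpen_discrete _)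

theorem isClosed_E : IsClosed T.E := by
  have : T.E = ⋂ a, ⋂ b, {x | a ≠ b → x a = T.δ a b ∨ x b = T.δ b a} := by
    ext x; simp [E]
  rw [this]
  refine isClosed_iInter fun a => isClosed_iInter fun b => ?_
  by_cases hab : a = b
  · simp [hab]
  · have : {x : B → Option D | a ≠ b → x a = T.δ a b ∨ x b = T.δ b a} =
        (fun x => x a) ⁻¹' {T.δ a b} ∪ (fun x => x b) ⁻¹' {T.δ b a} := by
      ext x; simp [hab]
    rw [this]
    exact ((isClosed_discrete _).preimage (continuous_apply a)).union
      ((isClosed_discrete _).preimage (continuous_apply b))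

/-- The set of points between `x` and `y`, upstairs. -/
def K (x y : B → Option D) : Set (B → Option D) := {z | z ∈ T.E ∧ ∀ b, x b = y b → z b = x b}

theorem isClosed_K (x y : B → Option D) : IsClosed (T.K x y) := by
  have : T.K x y = T.E ∩ ⋂ b, {z | x b = y b → z b = x b} := by
    ext z; simp [K]
  rw [this]
  refine T.isClosed_E.inter (isClosed_iInter fun b => ?_)
  by_cases hb : x b = y b
  · have : {z : B → Option D | x b = y b → z b = x b} = (fun z => z b) ⁻¹' {x b} := by
      ext z; simp [hb]
    rw [this]
    exact (isClosed_discrete _).preimage (continuous_apply b)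
  · simp [hb]

theorem left_mem_K {x y : B → Option D} (hx : x ∈ T.E) : x ∈ T.K x y := ⟨hx, fun _ _ => rfl⟩
theorem right_mem_K {x y : B → Option D} (hy : y ∈ T.E) : y ∈ T.K x y :=
  ⟨hy, fun _ h => h.symm⟩

theorem pt_mem_K {x y : B → Option D} (hx : x ∈ T.E) (hy : y ∈ T.E) {f : B}
    (hf : x f ≠ y f) (o : Option D) : T.pt f o ∈ T.K x y := by
  refine ⟨T.pt_mem f o, fun b hb => ?_⟩
  have hbf : b ≠ f := by rintro rfl; exact hf hb
  rw [T.pt_ne _ hbf]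
  rcases hx b f hbf with h1 | h1
  · exact h1.symm
  · rcases hy b f hbf with h2 | h2
    · rw [hb, h2]
    · exact absurd (h1.trans h2.symm) hf

theorem ne_of_K {x y z w : B → Option D} (hz : z ∈ T.K x y) (hw : w ∈ T.K x y) {f : B}
    (h : z f ≠ w f) : x f ≠ y f := fun h' => h ((hz.2 f h').trans (hw.2 f h').symm)

/-- The key combinatorial step: replacing `w` by a lift of `f` decreases the difference set. -/
theorem diff_step {z w : B → Option D} (hz : z ∈ T.E) (hw : w ∈ T.E) {f g : B}
    (hf : z f ≠ w f) (hg : z g ≠ T.pt f (z f) g) : z g ≠ w g ∧ g ≠ f := by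
  have hgf : g ≠ f := by rintro rfl; simp at hg
  refine ⟨?_, hgf⟩
  rw [T.pt_ne _ hgf] at hg
  rcases hz g f hgf with h1 | h1
  · exact absurd h1 hg
  · rcases hw g f hgf with h2 | h2
    · rw [h2]; exact hg
    · exact absurd (h1.trans h2.symm) hf

theorem exists_finset_of_open {O : Set (B → Option D)} (hO : IsOpen O) {x : B → Option D}
    (hx : x ∈ O) : ∃ F : Finset B, ∀ y, (∀ b ∈ F, y b = x b) → y ∈ O := by
  obtain ⟨F, u, hu, h⟩ := isOpen_pi_iff.1 hO x hx
  refine ⟨F, fun y hy => h ?_⟩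
  intro b hb
  rw [hy b hb]
  exact (hu b hb).2

variable [Finite D]

theorem isCompact_K (x y : B → Option D) : IsCompact (T.K x y) := (T.isClosed_K x y).isCompact

instance : CompactSpace T.X := by
  have : CompactSpace T.E := isCompact_iff_compactSpace.1 T.isClosed_E.isCompact
  refine ⟨?_⟩
  rw [← Set.range_eq_univ.2 T.r_surj]
  exact isCompact_range T.continuous_r

end top

end TreeStr
end WD
set_option linter.unusedSectionVars false
set_option linter.unusedVariables false

namespace WD
namespace TreeStr

variable {D B : Type} (T : TreeStr D B)

section top2

attribute [local instance] optTop optDisc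

variable [Finite D]

/-- The image in `X` of a segment. -/
def seg (x y : B → Option D) : Set T.X := {z | ∃ e : T.E, e.1 ∈ T.K x y ∧ T.r e = z}

theorem K_const (x y : B → Option D) (hx : x ∈ T.E) (hy : y ∈ T.E) (P : Set (B → Option D))
    (hloc : ∀ e ∈ T.K x y, ∃ F : Finset B, ∀ e' ∈ T.K x y, (∀ b ∈ F, e' b = e b) →
      (e' ∈ P ↔ e ∈ P))
    (hsat : ∀ f o o', T.pt f o ∈ T.K x y → T.pt f o' ∈ T.K x y → T.pt f o ∈ P → T.pt f o' ∈ P) :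
    ∀ z ∈ T.K x y, ∀ w ∈ T.K x y, z ∈ P → w ∈ P := by
  classical
  obtain ⟨F, hF⟩ : ∃ F : Finset B, ∀ e ∈ T.K x y, ∀ e' ∈ T.K x y, (∀ b ∈ F, e' b = e b) →
      (e' ∈ P ↔ e ∈ P) := by
    have := (T.isCompact_K x y).induction_on
      (p := fun s => ∃ F : Finset B, ∀ e ∈ s, e ∈ T.K x y → ∀ e' ∈ T.K x y,
        (∀ b ∈ F, e' b = e b) → (e' ∈ P ↔ e ∈ P)) ⟨∅, by simp⟩
      (fun s t hst ⟨F, hF⟩ => ⟨F, fun e he => hF e (hst he)⟩)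
      (fun s t ⟨F, hF⟩ ⟨F', hF'⟩ => ⟨F ∪ F', fun e he heK e' he' h => by
        rcases he with he | he
        · exact hF e he heK e' he' fun b hb => h b (Finset.mem_union_left _ hb)
        · exact hF' e he heK e' he' fun b hb => h b (Finset.mem_union_right _ hb)⟩)
      (fun e he => by
        obtain ⟨F, hF⟩ := hloc e he
        refine ⟨{e' | ∀ b ∈ F, e' b = e b}, mem_nhdsWithin_of_mem_nhds ?_, F, ?_⟩
        · have hO : IsOpen {e' : B → Option D | ∀ b ∈ F, e' b = e b} := by
            have : {e' : B → Option D | ∀ b ∈ F, e' b = e b} =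
                ⋂ b ∈ F, (fun z : B → Option D => z b) ⁻¹' {e b} := by
              ext z; simp
            rw [this]
            exact isOpen_biInter_finset fun b _ =>
              (isOpen_discrete _).preimage (continuous_apply b)
          exact hO.mem_nhds fun _ _ => rfl
        · intro e1 he1 he1K e2 he2 h
          rw [hF e1 he1K he1, hF e2 he2 fun b hb => (h b hb).trans (he1 b hb)])
    obtain ⟨F, hF⟩ := this
    exact ⟨F, fun e he => hF e he he⟩
  have key : ∀ k : ℕ, ∀ z ∈ T.K x y, ∀ w ∈ T.K x y,
      (F.filter fun b => z b ≠ w b).card = k → (z ∈ P → w ∈ P) := by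
    intro k
    induction k using Nat.strong_induction_on with
    | _ k ih =>
      intro z hz w hw hk hzP
      by_cases h : ∃ f ∈ F, z f ≠ w f
      · obtain ⟨f, hfF, hf⟩ := h
        have hxy := T.ne_of_K hz hw hf
        have hK : ∀ o, T.pt f o ∈ T.K x y := T.pt_mem_K hx hy hxy
        have h1 : (F.filter fun b => z b ≠ T.pt f (z f) b).card < k := by
          rw [← hk]
          refine Finset.card_lt_card ⟨fun g hg => ?_, fun hsub => ?_⟩
          · rw [Finset.mem_filter] at hg ⊢
            exact ⟨hg.1, (T.diff_step hz.1 hw.1 hf hg.2).1⟩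
          · have := hsub (Finset.mem_filter.2 ⟨hfF, hf⟩)
            rw [Finset.mem_filter] at this
            exact (T.diff_step hz.1 hw.1 hf this.2).2 rfl
        have h2 : (F.filter fun b => T.pt f (w f) b ≠ w b).card < k := by
          rw [← hk]
          refine Finset.card_lt_card ⟨fun g hg => ?_, fun hsub => ?_⟩
          · rw [Finset.mem_filter] at hg ⊢
            exact ⟨hg.1, (T.diff_step hw.1 hz.1 hf.symm hg.2.symm).1.symm⟩
          · have := hsub (Finset.mem_filter.2 ⟨hfF, hf⟩)
            rw [Finset.mem_filter] at this
            exact (T.diff_step hw.1 hz.1 hf.symm this.2.symm).2 rfl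
        have := ih _ h1 z hz _ (hK _) rfl hzP
        have := hsat f _ (w f) (hK _) (hK _) this
        exact ih _ h2 _ (hK _) w hw rfl this
      · push Not at h
        exact (hF z hz w hw fun b hb => (h b hb).symm).2 hzP
  exact fun z hz w hw => key _ z hz w hw rfl

theorem isPreconnected_seg {x y : B → Option D} (hx : x ∈ T.E) (hy : y ∈ T.E) :
    IsPreconnected (T.seg x y) := by
  rw [isPreconnected_iff_subset_of_disjoint]
  intro u v hu hv huv hdis
  -- status set
  let P : Set (B → Option D) := {e | ∃ h : e ∈ T.E, T.r ⟨e, h⟩ ∈ u}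
  have hloc : ∀ e ∈ T.K x y, ∃ F : Finset B, ∀ e' ∈ T.K x y, (∀ b ∈ F, e' b = e b) →
      (e' ∈ P ↔ e ∈ P) := by
    intro e he
    have aux : ∀ w : Set T.X, IsOpen w → T.r ⟨e, he.1⟩ ∈ w →
        ∃ F : Finset B, ∀ e' (he' : e' ∈ T.K x y), (∀ b ∈ F, e' b = e b) →
          T.r ⟨e', he'.1⟩ ∈ w := by
      intro w hw hew
      obtain ⟨O, hO, hOw⟩ := isOpen_induced_iff.1 (hw.preimage T.continuous_r)
      have h1 : (⟨e, he.1⟩ : T.E) ∈ T.r ⁻¹' w := hew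
      rw [← hOw] at h1
      obtain ⟨F, hF⟩ := exists_finset_of_open hO h1
      refine ⟨F, fun e' he' h => ?_⟩
      have h2 : (⟨e', he'.1⟩ : T.E) ∈ Subtype.val ⁻¹' O := hF e' h
      rw [hOw] at h2
      exact h2
    have hmem : ∀ e' (he' : e' ∈ T.K x y), T.r ⟨e', he'.1⟩ ∈ T.seg x y :=
      fun e' he' => ⟨⟨e', he'.1⟩, he', rfl⟩
    have hnot : ∀ e' (he' : e' ∈ T.K x y), T.r ⟨e', he'.1⟩ ∈ v → e' ∉ P := by
      rintro e' he' h1 ⟨h2, h3⟩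
      have : T.r ⟨e', he'.1⟩ ∈ T.seg x y ∩ (u ∩ v) := ⟨hmem e' he', h3, h1⟩
      rw [hdis] at this
      exact this
    rcases huv (hmem e he) with h | h
    · obtain ⟨F, hF⟩ := aux u hu h
      exact ⟨F, fun e' he' h' => ⟨fun _ => ⟨he.1, h⟩, fun _ => ⟨he'.1, hF e' he' h'⟩⟩⟩
    · obtain ⟨F, hF⟩ := aux v hv h
      exact ⟨F, fun e' he' h' => ⟨fun h1 => absurd h1 (hnot e' he' (hF e' he' h')),
        fun h1 => absurd h1 (hnot e he h)⟩⟩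
  have hsat : ∀ f o o', T.pt f o ∈ T.K x y → T.pt f o' ∈ T.K x y → T.pt f o ∈ P →
      T.pt f o' ∈ P := by
    rintro f o o' - - ⟨h1, h2⟩
    refine ⟨T.pt_mem f o', ?_⟩
    rw [r_pt] at h2 ⊢
    exact h2
  have hall := T.K_const x y hx hy P hloc hsat
  by_cases hxu : x ∈ P
  · left
    rintro _ ⟨e, he, rfl⟩
    obtain ⟨h1, h2⟩ := hall x (T.left_mem_K hx) e.1 he hxu
    exact h2
  · right
    rintro _ ⟨e, he, rfl⟩
    rcases huv ⟨e, he, rfl⟩ with h | h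
    · exact absurd (hall e.1 he x (T.left_mem_K hx) ⟨e.2, h⟩) hxu
    · exact h

/-- Segment between branch points. -/
def bseg (p q : B) : Set T.X := T.seg (T.pt p (T.δ p q)) (T.pt q (T.δ q p))

theorem isPreconnected_bseg (p q : B) : IsPreconnected (T.bseg p q) :=
  T.isPreconnected_seg (T.pt_mem _ _) (T.pt_mem _ _)

theorem left_mem_bseg (p q : B) : T.br p ∈ T.bseg p q :=
  ⟨⟨_, T.pt_mem p (T.δ p q)⟩, T.left_mem_K (T.pt_mem _ _), T.r_pt _ _⟩

theorem right_mem_bseg (p q : B) : T.br q ∈ T.bseg p q :=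
  ⟨⟨_, T.pt_mem q (T.δ q p)⟩, T.right_mem_K (T.pt_mem _ _), T.r_pt _ _⟩

theorem subset_U_of_preconnected {s : Set T.X} (hs : IsPreconnected s) {b : B}
    (hb : T.br b ∉ s) {x : T.X} (hx : x ∈ s) : s ⊆ T.U b (x.1 b) := by
  have hne : ∀ y ∈ s, y.1 b ≠ none := fun y hy h => hb (T.eq_br_of_none h ▸ hy)
  have ho : IsOpen {y : T.X | y.1 b ≠ none ∧ y.1 b ≠ x.1 b} := by
    have : {y : T.X | y.1 b ≠ none ∧ y.1 b ≠ x.1 b} =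
        ⋃ o : {o : Option D // o ≠ none ∧ o ≠ x.1 b}, T.U b o.1 := by
      ext y
      simp only [Set.mem_iUnion, mem_U]
      exact ⟨fun h => ⟨⟨y.1 b, h⟩, rfl⟩, fun ⟨o, h⟩ => by
        show y.1 b ≠ none ∧ _
        rw [h]; exact o.2⟩
    rw [this]
    exact isOpen_iUnion fun o => T.isOpen_U b o.2.1
  refine hs.subset_left_of_subset_union (T.isOpen_U b (hne x hx)) ho ?_ ?_ ⟨x, hx, rfl⟩
  · rw [Set.disjoint_left]
    rintro y h1 ⟨-, h2⟩
    exact h2 h1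
  · intro y hy
    by_cases h : y.1 b = x.1 b
    · exact Or.inl h
    · exact Or.inr ⟨hne y hy, h⟩

theorem br_mem_of_preconnected {s : Set T.X} (hs : IsPreconnected s) {b : B} {x y : T.X}
    (hx : x ∈ s) (hy : y ∈ s) (h : x.1 b ≠ y.1 b) : T.br b ∈ s := by
  by_contra hb
  exact h (T.subset_U_of_preconnected hs hb hx hy).symm

theorem bseg_subset {C : Set T.X} (hC : IsClosed C) (hconn : IsPreconnected C) {p q : B}
    (hp : T.br p ∈ C) (hq : T.br q ∈ C) : T.bseg p q ⊆ C := by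
  classical
  rintro _ ⟨z, hz, rfl⟩
  by_contra hzC
  obtain ⟨O, hO, hOw⟩ := isOpen_induced_iff.1 (hC.isOpen_compl.preimage T.continuous_r)
  have h1 : z ∈ T.r ⁻¹' Cᶜ := hzC
  rw [← hOw] at h1
  obtain ⟨F, hF⟩ := exists_finset_of_open hO h1
  have key : ∀ k : ℕ, ∀ w, ∀ hw : w ∈ T.K (T.pt p (T.δ p q)) (T.pt q (T.δ q p)),
      (F.filter fun b => z.1 b ≠ w b).card = k → T.r ⟨w, hw.1⟩ ∉ C := by
    intro k
    induction k using Nat.strong_induction_on with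
    | _ k ih =>
      intro w hw hk hwC
      by_cases h : ∃ f ∈ F, z.1 f ≠ w f
      · obtain ⟨f, hfF, hf⟩ := h
        have hxy := T.ne_of_K hz hw hf
        have hK := T.pt_mem_K (T.pt_mem _ _) (T.pt_mem _ _) hxy (z.1 f)
        have h1 : (F.filter fun b => z.1 b ≠ T.pt f (z.1 f) b).card < k := by
          rw [← hk]
          refine Finset.card_lt_card ⟨fun g hg => ?_, fun hsub => ?_⟩
          · rw [Finset.mem_filter] at hg ⊢
            exact ⟨hg.1, (T.diff_step hz.1 hw.1 hf hg.2).1⟩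
          · have := hsub (Finset.mem_filter.2 ⟨hfF, hf⟩)
            rw [Finset.mem_filter] at this
            exact (T.diff_step hz.1 hw.1 hf this.2).2 rfl
        refine ih _ h1 _ hK rfl ?_
        rw [r_pt]
        by_cases hfp : f = p
        · rw [hfp]; exact hp
        by_cases hfq : f = q
        · rw [hfq]; exact hq
        rw [T.pt_ne _ hfp, T.pt_ne _ hfq] at hxy
        exact T.br_mem_of_preconnected hconn hp hq hxy
      · push Not at h
        have h2 : (⟨w, hw.1⟩ : T.E) ∈ Subtype.val ⁻¹' O := hF w fun b hb => (h b hb).symm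
        rw [hOw] at h2
        exact h2 hwC
  refine key _ _ (T.left_mem_K (T.pt_mem _ _)) rfl ?_
  rw [r_pt]; exact hp

/-- Segments from a point `R e` to a branch point `p` lie on one side of `p`. -/
theorem seg_side {e : B → Option D} {p : B} {z : T.X}
    (hz : z ∈ T.seg e (T.pt p (e p))) : z.1 p = e p ∨ z = T.br p := by
  obtain ⟨z, hz, rfl⟩ := hz
  have h1 : z.1 p = e p := hz.2 p (by simp)
  rcases T.R_eq_or z.1 p with h | h
  · left; exact h.trans h1
  · right; exact T.eq_br_of_none h

theorem bseg_side {p q : B} {z : T.X} (hz : z ∈ T.bseg q p) : z.1 p = T.δ p q ∨ z = T.br p := by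
  by_cases hpq : p = q
  · subst hpq
    obtain ⟨z, hz, rfl⟩ := hz
    right
    have : z.1 = T.pt p (T.δ p p) := by
      funext b; exact hz.2 b rfl
    have h2 : z = ⟨_, T.pt_mem p (T.δ p p)⟩ := Subtype.ext this
    rw [h2, r_pt]
  · have h : T.pt q (T.δ q p) p = T.δ p q := T.pt_ne _ hpq
    unfold bseg at hz
    have := T.seg_side (e := T.pt q (T.δ q p)) (p := p) (z := z) (by rw [h]; exact hz)
    rwa [h] at this

/-- common initial part of two segments from `b`. -/
theorem initial {b p q : B} (hp : b ≠ p) (h : T.δ b p = T.δ b q) :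
    ∃ m, m ≠ b ∧ m ≠ p ∧ m ≠ q ∧ T.δ m p = T.δ m q ∧ T.δ m p ≠ T.δ m b ∧ T.δ b m = T.δ b p := by
  have hq : b ≠ q := by
    rintro rfl
    rw [T.self] at h
    exact T.ne_none hp h
  obtain ⟨m, hmb, hmp, hmq⟩ : ∃ m, m ≠ b ∧ (m = p ∨ T.δ m p ≠ T.δ m b) ∧
      (m = q ∨ T.δ m q ≠ T.δ m b) := by
    by_cases hpq : p = q
    · subst hpq; exact ⟨p, hp.symm, Or.inl rfl, Or.inl rfl⟩
    · obtain ⟨m, h1, h2, h3⟩ := T.med b p q hp hq hpq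
      refine ⟨m, ?_, Or.inr h1.symm, Or.inr h2.symm⟩
      rintro rfl
      exact h3 h
  obtain ⟨c, hcb, hcm, hc⟩ := T.dense b m hmb.symm
  -- from c, points p and q are in the direction of m
  have hdir : ∀ r, (m = r ∨ T.δ m r ≠ T.δ m b) → T.δ c r = T.δ c m := by
    rintro r (rfl | hr)
    · rfl
    · rcases T.tree c m r hcm with h1 | h1
      · exact h1
      · rcases T.tree c m b hcm with h2 | h2
        · exact absurd h2 hc
        · exact absurd (h1.trans h2.symm) hr
  have hne : ∀ r, T.δ c r = T.δ c m → c ≠ r := by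
    rintro r hr rfl
    rw [T.self] at hr
    exact T.ne_none hcm hr.symm
  have e1 := hdir p hmp
  have e2 := hdir q hmq
  refine ⟨c, hcb, hne p e1, hne q e2, e1.trans e2.symm, ?_, ?_⟩
  · rw [e1]; exact hc.symm
  · rcases T.tree c b p hcb with h1 | h1
    · exact absurd (h1.symm.trans e1) hc
    · exact h1.symm

theorem exists_wit {e : B → Option D} (he : e ∈ T.E) {b : B} (h : T.R e b ≠ none) :
    ∃ p, p ≠ b ∧ e p ≠ T.δ p b := by
  have hne : e ≠ T.pt b (e b) := by
    intro h'
    apply h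
    simp only [R, if_pos h']
  obtain ⟨p, hp⟩ := Function.ne_iff.1 hne
  have hpa : p ≠ b := by rintro rfl; simp at hp
  rw [T.pt_ne _ hpa] at hp
  exact ⟨p, hpa, hp⟩

theorem seg_subset_U {x y : T.E} {b : B} (hxy : (T.r x).1 b = (T.r y).1 b)
    (hn : (T.r x).1 b ≠ none) : T.seg x.1 y.1 ⊆ T.U b ((T.r x).1 b) := by
  have hn' : (T.r y).1 b ≠ none := hxy ▸ hn
  have ex : (T.r x).1 b = x.1 b := T.R_of_ne_none hn
  have ey : (T.r y).1 b = y.1 b := T.R_of_ne_none hn'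
  obtain ⟨p, hpb, hp⟩ := T.exists_wit x.2 hn
  obtain ⟨q, hqb, hq⟩ := T.exists_wit y.2 hn'
  have xb : x.1 b = T.δ b p := (x.2 b p hpb.symm).resolve_right hp
  have yb : y.1 b = T.δ b q := (y.2 b q hqb.symm).resolve_right hq
  have hd : T.δ b p = T.δ b q := by rw [← xb, ← yb, ← ex, ← ey, hxy]
  obtain ⟨m, hmb, hmp, hmq, h1, h2, h3⟩ := T.initial hpb.symm hd
  have xm : x.1 m = T.δ m p := by
    rcases x.2 m p hmp with h | h
    · exact h
    · rcases T.tree m p b hmp with h' | h'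
      · exact absurd h'.symm h2
      · exact absurd (h.trans h'.symm) hp
  have ym : y.1 m = T.δ m q := by
    rcases y.2 m q hmq with h | h
    · exact h
    · rcases T.tree m q b hmq with h' | h'
      · exact absurd h'.symm (h1 ▸ h2)
      · exact absurd (h.trans h'.symm) hq
  rintro _ ⟨z, hz, rfl⟩
  have zb : z.1 b = x.1 b := hz.2 b (by rw [← ex, ← ey, hxy])
  have zm : z.1 m = T.δ m p := (hz.2 m (by rw [xm, ym, h1])).trans xm
  rw [mem_U, ex, ← zb]
  have : z.1 ≠ T.pt b (z.1 b) := by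
    intro h
    have := congrFun h m
    rw [T.pt_ne _ hmb, zm] at this
    exact h2 this
  show T.R z.1 b = z.1 b
  simp only [R, if_neg this]

/-- Finite intersections of half-spaces are connected. -/
theorem isPreconnected_inter (f : Set (Set T.X)) (hf : f ⊆ {s | ∃ b i, s = T.U b (some i)}) :
    IsPreconnected (⋂₀ f) := by
  refine isPreconnected_of_forall_pair fun x hx y hy => ?_
  obtain ⟨ex, rfl⟩ := T.r_surj x
  obtain ⟨ey, rfl⟩ := T.r_surj y
  refine ⟨T.seg ex.1 ey.1, ?_, ⟨ex, T.left_mem_K ex.2, rfl⟩, ⟨ey, T.right_mem_K ey.2, rfl⟩,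
    T.isPreconnected_seg ex.2 ey.2⟩
  refine Set.subset_sInter fun s hs => ?_
  obtain ⟨b, i, rfl⟩ := hf hs
  have h1 : (T.r ex).1 b = some i := hx _ hs
  have h2 : (T.r ey).1 b = some i := hy _ hs
  have := T.seg_subset_U (h1.trans h2.symm) (by rw [h1]; simp)
  rwa [h1] at this

theorem isPreconnected_U (b : B) {o : Option D} (ho : o ≠ none) : IsPreconnected (T.U b o) := by
  obtain ⟨i, rfl⟩ := Option.ne_none_iff_exists'.1 ho
  have := T.isPreconnected_inter {T.U b (some i)} (by
    rintro s rfl; exact ⟨b, i, rfl⟩)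
  simpa using this

end top2

end TreeStr
end WD
namespace WD

theorem circle_compl_preconnected (c : Circle) : IsPreconnected ({c}ᶜ : Set Circle) := by
  have hexp : Circle.exp (Complex.arg c) = c := Circle.exp_arg c
  have : ({c}ᶜ : Set Circle) =
      Circle.exp '' (Set.Ioo (Complex.arg c) (Complex.arg c + 2 * Real.pi)) := by
    ext z
    simp only [Set.mem_compl_iff, Set.mem_singleton_iff, Set.mem_image]
    constructor
    · intro hz
      set t := Complex.arg c with ht
      obtain ⟨s, hs, hs'⟩ : ∃ s, t ≤ s ∧ s < t + 2 * Real.pi ∧ Circle.exp s = z := by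
        have h2 : (0 : ℝ) < 2 * Real.pi := by positivity
        refine ⟨toIcoMod h2 t (Complex.arg z), (toIcoMod_mem_Ico h2 t _).1,
          (toIcoMod_mem_Ico h2 t _).2, ?_⟩
        have : Circle.exp (toIcoMod h2 t (Complex.arg z)) = Circle.exp (Complex.arg z) := by
          rw [Circle.exp_eq_exp]
          refine ⟨-toIcoDiv h2 t (Complex.arg z), ?_⟩
          have := toIcoMod_add_toIcoDiv_zsmul h2 t (Complex.arg z)
          rw [zsmul_eq_mul] at this
          push_cast
          linarith
        rw [this]; exact Circle.exp_arg z
      refine ⟨s, ⟨lt_of_le_of_ne hs ?_, hs'.1⟩, hs'.2⟩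
      rintro rfl
      exact hz (hs'.2.symm.trans hexp)
    · rintro ⟨s, ⟨h1, h2⟩, rfl⟩ h
      rw [← hexp, Circle.exp_eq_exp] at h
      obtain ⟨m, hm⟩ := h
      have hpi := Real.pi_pos
      have h3 : (0 : ℝ) < m := by
        by_contra hneg
        push Not at hneg
        nlinarith
      have h4 : (m : ℝ) < 1 := by
        by_contra hneg
        push Not at hneg
        nlinarith
      have h5 : 0 < m := by exact_mod_cast h3
      have h6 : m < 1 := by exact_mod_cast h4
      omega
  rw [this]
  exact isPreconnected_Ioo.image _ Circle.exp.continuous.continuousOn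

theorem preconnectedSpace_of_homeo {Y Z : Type*} [TopologicalSpace Y] [TopologicalSpace Z]
    [PreconnectedSpace Y] (f : Y ≃ₜ Z) : PreconnectedSpace Z := by
  refine ⟨?_⟩
  have := (isPreconnected_univ (α := Y)).image f f.continuous.continuousOn
  rwa [Set.image_univ, f.surjective.range_eq] at this

namespace TreeStr

variable {D B : Type} (T : TreeStr D B) [Fintype D]

instance [Countable B] : SecondCountableTopology T.X := by
  refine ⟨⟨_, ?_, rfl⟩⟩
  have : {s | ∃ b i, s = T.U b (some i)} = Set.range fun bi : B × D => T.U bi.1 (some bi.2) := by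
    ext s
    constructor
    · rintro ⟨b, i, rfl⟩; exact ⟨(b, i), rfl⟩
    · rintro ⟨⟨b, i⟩, rfl⟩; exact ⟨b, i, rfl⟩
  rw [this]
  exact Set.countable_range _

instance : LocallyConnectedSpace T.X := by
  have hb := TopologicalSpace.isTopologicalBasis_of_subbasis
    (t := (inferInstance : TopologicalSpace T.X)) (s := {s | ∃ b i, s = T.U b (some i)}) rfl
  refine locallyConnectedSpace_of_connected_bases
    (fun x (s : Set T.X) => s) (fun x s => s ∈ (fun f => ⋂₀ f) '' {f | f.Finite ∧ f ⊆ {s | ∃ b i, s = T.U b (some i)}} ∧ x ∈ s) ?_ ?_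
  · intro x
    exact hb.nhds_hasBasis
  · rintro x s ⟨⟨f, ⟨-, hf⟩, rfl⟩, -⟩
    exact T.isPreconnected_inter f hf

theorem preconnectedSpace : PreconnectedSpace T.X := by
  refine ⟨?_⟩
  have := T.isPreconnected_inter ∅ (by simp)
  simpa using this

/-- A preconnected set with two points contains a branch point separating them. -/
theorem exists_br_sep {s : Set T.X} (hs : IsPreconnected s) {x y : T.X} (hx : x ∈ s) (hy : y ∈ s)
    (h : x ≠ y) : ∃ b, T.br b ∈ s ∧ x.1 b ≠ none ∧ y.1 b ≠ none ∧ x.1 b ≠ y.1 b := by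
  obtain ⟨b, h1, h2, h3⟩ := T.sep h
  exact ⟨b, T.br_mem_of_preconnected hs hx hy h3, h1, h2, h3⟩

theorem no_circle (S : Set T.X) : IsEmpty (S ≃ₜ Circle) := by
  refine ⟨fun f => ?_⟩
  have hS : IsPreconnected S := by
    rw [isPreconnected_iff_preconnectedSpace]
    have : PreconnectedSpace Circle := by
      have h := (isPreconnected_univ (α := ℝ)).image Circle.exp Circle.exp.continuous.continuousOn
      rw [Set.image_univ] at h
      refine ⟨?_⟩
      have h2 : Set.range Circle.exp = Set.univ :=
        Set.range_eq_univ.2 fun z => ⟨_, Circle.exp_arg z⟩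
      rwa [h2] at h
    exact preconnectedSpace_of_homeo f.symm
  have hne : f.symm 1 ≠ f.symm (-1) := by
    intro h
    have h1 := f.symm.injective h
    have h2 := congrArg (fun z : Circle => (z : ℂ).re) h1
    norm_num at h2
  obtain ⟨b, hb, h1, h2, h3⟩ := T.exists_br_sep hS (f.symm 1).2 (f.symm (-1)).2
    (fun h => hne (Subtype.ext h))
  have hc := circle_compl_preconnected (f ⟨T.br b, hb⟩)
  have hc2 := hc.image (fun z => (f.symm z : T.X))
    (continuous_subtype_val.comp f.symm.continuous).continuousOn
  have hmem : ∀ z : S, z.1 ≠ T.br b →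
      z.1 ∈ (fun z => (f.symm z : T.X)) '' ({f ⟨T.br b, hb⟩}ᶜ : Set Circle) := by
    intro z hz
    refine ⟨f z, ?_, by simp⟩
    intro h
    have h : f z = f ⟨T.br b, hb⟩ := h
    exact hz (congrArg Subtype.val (f.injective h))
  have hx := hmem (f.symm 1) (fun h => h1 (by rw [h]; exact T.self b))
  have hy := hmem (f.symm (-1)) (fun h => h2 (by rw [h]; exact T.self b))
  have := T.br_mem_of_preconnected hc2 hx hy h3
  obtain ⟨z, hz, hz'⟩ := this
  apply hz
  have : f.symm z = ⟨T.br b, hb⟩ := Subtype.ext hz'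
  show z = f ⟨T.br b, hb⟩
  rw [← this]; simp

theorem ptOrder_br (b : B) : ptOrder T.X (T.br b) = Fintype.card D := by
  have h : setComponents T.X {T.br b}ᶜ = Set.range fun i : D => T.U b (some i) := by
    have hcomp : ∀ x : T.X, x ≠ T.br b →
        connectedComponentIn {T.br b}ᶜ x = T.U b (x.1 b) := by
      intro x hx
      have hn := T.ne_none_of_ne_br hx
      apply Set.Subset.antisymm
      · refine T.subset_U_of_preconnected isPreconnected_connectedComponentIn ?_
          (mem_connectedComponentIn hx)
        intro h
        exact connectedComponentIn_subset _ _ h rfl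
      · refine (T.isPreconnected_U b hn).subset_connectedComponentIn rfl ?_
        intro y hy hyb
        have hyb : y = T.br b := hyb
        subst hyb
        have hy : T.δ b b = x.1 b := hy
        rw [T.self] at hy
        exact hn hy.symm
    ext C
    constructor
    · rintro ⟨x, hx, rfl⟩
      have hn := T.ne_none_of_ne_br hx
      obtain ⟨i, hi⟩ := Option.ne_none_iff_exists'.1 hn
      refine ⟨i, ?_⟩
      show T.U b (some i) = _
      rw [hcomp x hx, hi]
    · rintro ⟨i, rfl⟩
      obtain ⟨p, hp⟩ := T.surj b i
      have hne : T.br p ≠ T.br b := by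
        intro h
        rw [T.br_inj h, T.self] at hp
        simp at hp
      refine ⟨T.br p, hne, ?_⟩
      rw [hcomp _ hne, br_val, hp]
  have hinj : Function.Injective fun i : D => T.U b (some i) := by
    intro i j hij
    obtain ⟨p, hp⟩ := T.surj b i
    have h1 : T.br p ∈ T.U b (some i) := hp
    have hij : T.U b (some i) = T.U b (some j) := hij
    rw [hij] at h1
    have h1 : T.δ b p = some j := h1
    rw [hp] at h1
    exact Option.some.inj h1
  rw [ptOrder, h, ← Set.image_univ, Set.ncard_image_of_injective _ hinj, Set.ncard_univ,
    Nat.card_eq_fintype_card]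

/-- Among three branch points, two are joined avoiding a given non-branch point
(or any point which is not their median). -/
theorem joined_of_three (z : T.X) (hz : ∀ b, z ≠ T.br b) (a b c : B) :
    ∃ s : Set T.X, IsPreconnected s ∧ z ∉ s ∧
      (∀ C : Set T.X, IsClosed C → IsPreconnected C → T.br a ∈ C → T.br b ∈ C → T.br c ∈ C →
        s ⊆ C) ∧
      ((T.br a ∈ s ∧ T.br b ∈ s) ∨ (T.br a ∈ s ∧ T.br c ∈ s) ∨ (T.br b ∈ s ∧ T.br c ∈ s)) := by
  have triv : ∀ p, IsPreconnected ({T.br p} : Set T.X) ∧ z ∉ ({T.br p} : Set T.X) :=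
    fun p => ⟨isPreconnected_singleton, fun h => hz p h⟩
  by_cases hab : a = b
  · subst hab
    exact ⟨{T.br a}, (triv a).1, (triv a).2, by rintro C - - h - - x rfl; exact h,
      Or.inl ⟨rfl, rfl⟩⟩
  by_cases hac : a = c
  · subst hac
    exact ⟨{T.br a}, (triv a).1, (triv a).2, by rintro C - - h - - x rfl; exact h,
      Or.inr (Or.inl ⟨rfl, rfl⟩)⟩
  by_cases hbc : b = c
  · subst hbc
    exact ⟨{T.br b}, (triv b).1, (triv b).2, by rintro C - - - h - x rfl; exact h,
      Or.inr (Or.inr ⟨rfl, rfl⟩)⟩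
  obtain ⟨m, h1, h2, h3⟩ := T.med a b c hab hac hbc
  have av : ∀ p, T.δ m p ≠ z.1 m → z ∉ T.bseg p m := by
    intro p hp h
    rcases T.bseg_side h with h | h
    · exact hp h.symm
    · exact hz m h
  have main : ∀ p q, T.δ m p ≠ T.δ m q → T.δ m p ≠ z.1 m → T.δ m q ≠ z.1 m →
      ∃ s : Set T.X, IsPreconnected s ∧ z ∉ s ∧
      (∀ C : Set T.X, IsClosed C → IsPreconnected C → T.br p ∈ C → T.br q ∈ C → s ⊆ C) ∧
      T.br p ∈ s ∧ T.br q ∈ s := by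
    intro p q hpq hp hq
    refine ⟨T.bseg p m ∪ T.bseg q m, ?_, ?_, ?_, Or.inl (T.left_mem_bseg _ _),
      Or.inr (T.left_mem_bseg _ _)⟩
    · exact (T.isPreconnected_bseg p m).union (T.br m) (T.right_mem_bseg _ _)
        (T.right_mem_bseg _ _) (T.isPreconnected_bseg q m)
    · rintro (h | h)
      · exact av p hp h
      · exact av q hq h
    · intro C hC hC' hpC hqC
      have hm : T.br m ∈ C := T.br_mem_of_preconnected hC' hpC hqC hpq
      exact Set.union_subset (T.bseg_subset hC hC' hpC hm) (T.bseg_subset hC hC' hqC hm)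
  by_cases ha : T.δ m a = z.1 m
  · obtain ⟨s, s1, s2, s3, s4, s5⟩ := main b c h3 (ha ▸ h1.symm) (ha ▸ h2.symm)
    exact ⟨s, s1, s2, fun C a1 a2 _ a4 a5 => s3 C a1 a2 a4 a5, Or.inr (Or.inr ⟨s4, s5⟩)⟩
  · by_cases hb : T.δ m b = z.1 m
    · obtain ⟨s, s1, s2, s3, s4, s5⟩ := main a c h2 ha (hb ▸ h3.symm)
      exact ⟨s, s1, s2, fun C a1 a2 a3 _ a5 => s3 C a1 a2 a3 a5, Or.inr (Or.inl ⟨s4, s5⟩)⟩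
    · obtain ⟨s, s1, s2, s3, s4, s5⟩ := main a b h1 ha hb
      exact ⟨s, s1, s2, fun C a1 a2 a3 a4 _ => s3 C a1 a2 a3 a4, Or.inl ⟨s4, s5⟩⟩

theorem comp_eq_br {z : T.X} (hz : ∀ b, z ≠ T.br b) {y : T.X} (hy : y ≠ z) :
    ∃ b, connectedComponentIn {z}ᶜ y = connectedComponentIn {z}ᶜ (T.br b) := by
  obtain ⟨b, h1, h2, h3⟩ := T.sep hy
  obtain ⟨e, rfl⟩ := T.r_surj y
  refine ⟨b, ?_⟩
  have he : (T.r e).1 b = e.1 b := T.R_of_ne_none h1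
  have hs := T.isPreconnected_seg e.2 (T.pt_mem b (e.1 b))
  have hzs : T.seg e.1 (T.pt b (e.1 b)) ⊆ {z}ᶜ := by
    intro w hw hwz
    have hwz : w = z := hwz
    subst hwz
    rcases T.seg_side hw with h | h
    · exact h3 (he.trans h.symm)
    · exact hz b h
  have hl : T.r e ∈ T.seg e.1 (T.pt b (e.1 b)) := ⟨e, T.left_mem_K e.2, rfl⟩
  have hr : T.br b ∈ T.seg e.1 (T.pt b (e.1 b)) :=
    ⟨⟨_, T.pt_mem b (e.1 b)⟩, T.right_mem_K (T.pt_mem _ _), T.r_pt _ _⟩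
  exact connectedComponentIn_eq (hs.subset_connectedComponentIn hl hzs hr)

theorem ptOrder_nonbr [Nonempty B] {z : T.X} (hz : ∀ b, z ≠ T.br b) :
    ptOrder T.X z = 1 ∨ ptOrder T.X z = 2 := by
  have hle : (setComponents T.X {z}ᶜ).encard ≤ 2 := by
    by_contra hlt
    push Not at hlt
    have h3le : (3 : ℕ∞) ≤ (setComponents T.X {z}ᶜ).encard := by
      have := Order.add_one_le_of_lt hlt
      norm_num at this
      exact this
    obtain ⟨t, htsub, htc⟩ := Set.exists_subset_encard_eq h3le
    obtain ⟨p1, p2, p3, h1, h2, h3, rfl⟩ := Set.encard_eq_three.1 htc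
    replace hlt : ∃ a b c, a ∈ setComponents T.X {z}ᶜ ∧ b ∈ setComponents T.X {z}ᶜ ∧
        c ∈ setComponents T.X {z}ᶜ ∧ a ≠ b ∧ a ≠ c ∧ b ≠ c :=
      ⟨p1, p2, p3, htsub (by simp), htsub (by simp), htsub (by simp), h1, h2, h3⟩
    clear h1 h2 h3
    obtain ⟨_, _, _, ⟨a', ha, rfl⟩, ⟨b', hb, rfl⟩, ⟨c', hc, rfl⟩, h1, h2, h3⟩ := hlt
    obtain ⟨a, ha'⟩ := T.comp_eq_br hz ha
    obtain ⟨b, hb'⟩ := T.comp_eq_br hz hb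
    obtain ⟨c, hc'⟩ := T.comp_eq_br hz hc
    rw [ha', hb'] at h1
    rw [ha', hc'] at h2
    rw [hb', hc'] at h3
    obtain ⟨s, s1, s2, -, s3⟩ := T.joined_of_three z hz a b c
    have hsub : s ⊆ {z}ᶜ := fun w hw hwz => s2 (by
      have hwz : w = z := hwz
      rwa [← hwz])
    have heq : ∀ p q, T.br p ∈ s → T.br q ∈ s →
        connectedComponentIn {z}ᶜ (T.br p) = connectedComponentIn {z}ᶜ (T.br q) :=
      fun p q hp hq => connectedComponentIn_eq (s1.subset_connectedComponentIn hp hsub hq)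
    rcases s3 with h | h | h
    · exact h1 (heq _ _ h.1 h.2)
    · exact h2 (heq _ _ h.1 h.2)
    · exact h3 (heq _ _ h.1 h.2)
  have hfin : (setComponents T.X {z}ᶜ).Finite :=
    Set.finite_of_encard_le_coe (k := 2) hle
  have hne : (setComponents T.X {z}ᶜ).Nonempty := by
    obtain ⟨b⟩ := ‹Nonempty B›
    exact ⟨_, T.br b, fun h => hz b (Eq.symm h), rfl⟩
  have h2 : ptOrder T.X z ≤ 2 := by
    unfold ptOrder
    rw [← hfin.cast_ncard_eq] at hle
    exact_mod_cast hle
  have h1 : 0 < ptOrder T.X z := (Set.ncard_pos hfin).2 hne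
  omega

theorem eq_br_of_ptOrder [Nonempty B] (hD : 3 ≤ Fintype.card D) {z : T.X}
    (hz : ptOrder T.X z = Fintype.card D) : ∃ b, z = T.br b := by
  by_contra h
  push Not at h
  rcases T.ptOrder_nonbr h with h | h <;> omega

theorem isWazewski [Nonempty B] [Countable B] {n : ℕ} (hn : Fintype.card D = n) :
    IsWazewskiDendrite n T.X := by
  have hne : Nonempty T.X := ⟨T.br (Classical.arbitrary B)⟩
  have := T.preconnectedSpace
  refine ⟨⟨hne, inferInstance, ConnectedSpace.mk hne, inferInstance, inferInstance, T.no_circle⟩, ?_, ?_⟩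
  · intro p
    by_cases h : ∃ b, p = T.br b
    · obtain ⟨b, rfl⟩ := h
      right; right; rw [T.ptOrder_br, hn]
    · push Not at h
      rcases T.ptOrder_nonbr h with h | h <;> simp [h]
  · rintro A ⟨f⟩
    have hA : IsPreconnected A := by
      rw [isPreconnected_iff_preconnectedSpace]
      exact preconnectedSpace_of_homeo f.symm
    have hne : f.symm 0 ≠ f.symm 1 := by
      intro h
      have := f.symm.injective h
      exact zero_ne_one this
    obtain ⟨b, hb, -⟩ := T.exists_br_sep hA (f.symm 0).2 (f.symm 1).2
      (fun h => hne (Subtype.ext h))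
    exact ⟨_, hb, by rw [T.ptOrder_br, hn]⟩

end TreeStr
end WD
namespace WD
namespace TreeStr

theorem p_ai {B : Type} (g : Equiv.Perm B) (b : B) : g (g⁻¹ b) = b := g.apply_symm_apply b

theorem p_ia {B : Type} (g : Equiv.Perm B) (b : B) : g⁻¹ (g b) = b := g.symm_apply_apply b

variable {D B : Type} [Finite D] (T : TreeStr D B)

/-- Automorphisms of the tree structure. -/
def IsAut (g : Equiv.Perm B) : Prop :=
  ∀ a b c, T.δ a b = T.δ a c ↔ T.δ (g a) (g b) = T.δ (g a) (g c)

/-- The group of automorphisms. -/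
def autGroup : Subgroup (Equiv.Perm B) where
  carrier := {g | T.IsAut g}
  mul_mem' := by
    intro f g hf hg a b c
    exact (hg a b c).trans (hf (g a) (g b) (g c))
  one_mem' := fun a b c => Iff.rfl
  inv_mem' := by
    intro g hg a b c
    have := hg (g⁻¹ a) (g⁻¹ b) (g⁻¹ c)
    simp only [p_ai] at this
    exact this.symm

theorem mem_autGroup {g : Equiv.Perm B} : g ∈ T.autGroup ↔ T.IsAut g := Iff.rfl

theorem prop_iff (x : B → Option D) : (∃ e ∈ T.E, T.R e = x) ↔
    x ∈ T.E ∧ ∀ b, x b ≠ none → ∃ p, p ≠ b ∧ x p ≠ T.δ p b := by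
  constructor
  · rintro ⟨e, he, rfl⟩
    by_cases h : ∃ b, e = T.pt b (e b)
    · obtain ⟨b, hb⟩ := h
      rw [hb, R_pt]
      refine ⟨?_, ?_⟩
      · rw [← T.pt_none]; exact T.pt_mem _ _
      · intro a ha
        have hab : a ≠ b := by rintro rfl; exact ha (T.self a)
        obtain ⟨c, h1, h2, h3⟩ := T.dense a b hab
        exact ⟨c, h1, h3.symm⟩
    · push Not at h
      have hR : T.R e = e := by
        funext b; simp only [R, if_neg (h b)]
      rw [hR]
      refine ⟨he, fun b hb => ?_⟩
      exact T.exists_wit he (by rw [hR]; exact hb)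
  · rintro ⟨hx, h⟩
    refine ⟨x, hx, ?_⟩
    funext b
    unfold R
    split_ifs with hb
    · by_contra hne
      obtain ⟨p, hp, hp'⟩ := h b (Ne.symm hne)
      apply hp'
      rw [hb, T.pt_ne _ hp]
    · rfl

theorem exists_dir (b : B) (o : Option D) : ∃ p, T.δ b p = o := by
  cases o with
  | none => exact ⟨b, T.self b⟩
  | some i => exact T.surj b i

/-- A point in the given direction. -/
noncomputable def wit (b : B) (o : Option D) : B := (T.exists_dir b o).choose

theorem wit_spec (b : B) (o : Option D) : T.δ b (T.wit b o) = o := (T.exists_dir b o).choose_spec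

/-- Action of an automorphism. -/
noncomputable def actFun (g : Equiv.Perm B) (x : B → Option D) : B → Option D :=
  fun a => T.δ a (g (T.wit (g⁻¹ a) (x (g⁻¹ a))))

theorem actFun_apply {g : Equiv.Perm B} (hg : T.IsAut g) {x : B → Option D} {b p : B}
    (h : x b = T.δ b p) : T.actFun g x (g b) = T.δ (g b) (g p) := by
  unfold actFun
  simp only [p_ia]
  rw [← hg, T.wit_spec, h]

theorem actFun_prop {g : Equiv.Perm B} (hg : T.IsAut g) (x : T.X) :
    ∃ e ∈ T.E, T.R e = T.actFun g x.1 := by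
  have hx := (T.prop_iff x.1).1 x.2
  rw [T.prop_iff]
  refine ⟨?_, ?_⟩
  · intro a b hab
    obtain ⟨a, rfl⟩ := g.surjective a
    obtain ⟨b, rfl⟩ := g.surjective b
    have hab' : a ≠ b := fun h => hab (by rw [h])
    rcases hx.1 a b hab' with h | h
    · left; exact T.actFun_apply hg h
    · right; exact T.actFun_apply hg h
  · intro b hb
    obtain ⟨b, rfl⟩ := g.surjective b
    have hb' : x.1 b ≠ none := by
      intro h
      apply hb
      rw [T.actFun_apply hg (p := b) (by rw [h, T.self]), T.self]
    obtain ⟨p, hp, hp'⟩ := hx.2 b hb'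
    refine ⟨g p, fun h => hp (g.injective h), ?_⟩
    rw [T.actFun_apply hg (T.wit_spec p (x.1 p)).symm]
    intro h
    rw [← hg, T.wit_spec] at h
    exact hp' h

/-- Action of an automorphism on the completion. -/
noncomputable def act {g : Equiv.Perm B} (hg : T.IsAut g) (x : T.X) : T.X :=
  ⟨T.actFun g x.1, T.actFun_prop hg x⟩

theorem act_apply {g : Equiv.Perm B} (hg : T.IsAut g) {x : T.X} {b p : B}
    (h : x.1 b = T.δ b p) : (T.act hg x).1 (g b) = T.δ (g b) (g p) := T.actFun_apply hg h

theorem act_act {g f : Equiv.Perm B} (hg : T.IsAut g) (hf : T.IsAut f) (h : ∀ b, f (g b) = b)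
    (x : T.X) : T.act hf (T.act hg x) = x := by
  apply T.X_ext
  funext b
  have h1 := T.act_apply hg (T.wit_spec b (x.1 b)).symm
  have h2 := T.act_apply hf h1
  rw [h, h, T.wit_spec] at h2
  exact h2

theorem continuous_act {g : Equiv.Perm B} (hg : T.IsAut g) : Continuous (T.act hg) := by
  refine continuous_generateFrom_iff.2 ?_
  rintro s ⟨b, i, rfl⟩
  obtain ⟨b, rfl⟩ := g.surjective b
  obtain ⟨p, hp⟩ := T.surj (g b) i
  obtain ⟨p, rfl⟩ := g.surjective p
  have : T.act hg ⁻¹' (T.U (g b) (some i)) = T.U b (T.δ b p) := by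
    ext x
    have h1 := T.act_apply hg (T.wit_spec b (x.1 b)).symm
    show (T.act hg x).1 (g b) = some i ↔ x.1 b = T.δ b p
    rw [h1, ← hp, ← hg, T.wit_spec]
  rw [this]
  refine T.isOpen_U b (T.ne_none ?_)
  rintro rfl
  rw [T.self] at hp
  simp at hp

theorem exists_homeo {g : Equiv.Perm B} (hg : T.IsAut g) :
    ∃ h : T.X ≃ₜ T.X, ∀ b, h (T.br b) = T.br (g b) := by
  have hg' : T.IsAut g⁻¹ := T.autGroup.inv_mem hg
  refine ⟨{ toFun := T.act hg, invFun := T.act hg',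
            left_inv := T.act_act hg hg' (by simp), right_inv := T.act_act hg' hg (by simp),
            continuous_toFun := T.continuous_act hg,
            continuous_invFun := T.continuous_act hg' }, fun b => ?_⟩
  apply T.X_ext
  funext a
  obtain ⟨a, rfl⟩ := g.surjective a
  exact T.act_apply hg (x := T.br b) (b := a) (p := b) rfl

/-- Finitely generated groups of automorphisms lift to the completion. -/
theorem lift_group (S : Set (Equiv.Perm B)) (hS : S.Finite) (hA : ∀ g ∈ S, T.IsAut g) :
    ∃ G : Subgroup (T.X ≃ₜ T.X), G.FG ∧
      ∀ g ∈ Subgroup.closure S, ∃ h ∈ G, ∀ b, h (T.br b) = T.br (g b) := by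
  classical
  let f : Equiv.Perm B → (T.X ≃ₜ T.X) := fun g =>
    if hg : T.IsAut g then (T.exists_homeo hg).choose else 1
  have hf : ∀ g ∈ S, ∀ b, f g (T.br b) = T.br (g b) := by
    intro g hg b
    simp only [f, dif_pos (hA g hg)]
    exact (T.exists_homeo (hA g hg)).choose_spec b
  refine ⟨Subgroup.closure (f '' S), ?_, ?_⟩
  · exact (Subgroup.fg_iff _).2 ⟨_, rfl, hS.image f⟩
  · intro g hg
    induction hg using Subgroup.closure_induction with
    | mem g hg => exact ⟨f g, Subgroup.subset_closure ⟨g, hg, rfl⟩, hf g hg⟩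
    | one => exact ⟨1, one_mem _, fun b => rfl⟩
    | mul g g' _ _ h h' =>
      obtain ⟨k, hk, hk2⟩ := h
      obtain ⟨k', hk', hk2'⟩ := h'
      refine ⟨k * k', mul_mem hk hk', fun b => ?_⟩
      show k (k' (T.br b)) = _
      rw [hk2', hk2]; rfl
    | inv g _ h =>
      obtain ⟨k, hk, hk2⟩ := h
      refine ⟨k⁻¹, inv_mem hk, fun b => ?_⟩
      show k.symm (T.br b) = _
      rw [Homeomorph.symm_apply_eq, hk2, p_ai]

/-- Median-closed sets. -/
def MedClosed (M : Finset B) : Prop :=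
  ∀ x ∈ M, ∀ y ∈ M, ∀ z ∈ M, ∀ m, T.δ m x ≠ T.δ m y → T.δ m x ≠ T.δ m z → T.δ m y ≠ T.δ m z →
    m ∈ M

theorem exists_leaf {M : Finset B} (hM : T.MedClosed M) (h : ∃ b ∈ M, ∃ p ∈ M, b ≠ p) :
    ∃ b ∈ M, ∃ p ∈ M, b ≠ p ∧ ∀ r ∈ M, T.δ b r = T.δ b p → r = p := by
  classical
  have key : ∀ k : ℕ, ∀ b ∈ M, ∀ p ∈ M, b ≠ p → (M.filter fun r => T.δ b r = T.δ b p).card = k →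
      ∃ b ∈ M, ∃ p ∈ M, b ≠ p ∧ ∀ r ∈ M, T.δ b r = T.δ b p → r = p := by
    intro k
    induction k using Nat.strong_induction_on with
    | _ k ih =>
      intro b hb p hp hbp hk
      by_cases hr : ∀ r ∈ M, T.δ b r = T.δ b p → r = p
      · exact ⟨b, hb, p, hp, hbp, hr⟩
      · push Not at hr
        obtain ⟨r, hr, hrp, hne⟩ := hr
        have hbr : b ≠ r := by
          rintro rfl
          rw [T.self] at hrp
          exact T.ne_none hbp hrp.symm
        obtain ⟨m, h1, h2, h3⟩ := T.med b p r hbp hbr hne.symm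
        have hmM := hM b hb p hp r hr m h1 h2 h3
        have hmb : m ≠ b := by
          rintro rfl; exact h3 hrp.symm
        -- a point q of {p, r} different from m
        obtain ⟨q, hq, hqm, hqb, hqd⟩ : ∃ q ∈ M, m ≠ q ∧ T.δ m b ≠ T.δ m q ∧
            T.δ b q = T.δ b p := by
          by_cases hmp : m = p
          · refine ⟨r, hr, ?_, h2, hrp⟩
            rintro rfl; exact hne hmp
          · exact ⟨p, hp, hmp, h1, rfl⟩
        have hbm : T.δ b m = T.δ b p := by
          rcases T.tree m b q hmb with h | h
          · exact absurd h.symm hqb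
          · rw [← h, hqd]
        refine ih _ ?_ m hmM q hq hqm rfl
        rw [← hk]
        refine Finset.card_lt_card ⟨fun s hs => ?_, fun hsub => ?_⟩
        · rw [Finset.mem_filter] at hs ⊢
          refine ⟨hs.1, ?_⟩
          rcases T.tree m b s hmb with h | h
          · exact absurd (h.symm.trans hs.2) hqb
          · rw [h, hbm]
        · have := hsub (Finset.mem_filter.2 ⟨hmM, hbm⟩)
          rw [Finset.mem_filter, T.self] at this
          exact T.ne_none hqm this.2.symm
  obtain ⟨b, hb, p, hp, hbp⟩ := h
  exact key _ b hb p hp hbp rfl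

theorem homog (Γ : Subgroup (Equiv.Perm B)) (hΓ : Γ ≤ T.autGroup)
    (htr : ∀ a b : B, ∃ g ∈ Γ, g a = b)
    (hA : ∀ b p p' : B, p ≠ b → p' ≠ b → ∃ g ∈ Γ, g p = p' ∧
      ∀ r, T.δ b r ≠ T.δ b p → T.δ b r ≠ T.δ b p' → g r = r)
    (M : Finset B) (hM : T.MedClosed M) (φ : B → B)
    (hφ : ∀ a ∈ M, ∀ b ∈ M, ∀ c ∈ M, T.δ a b = T.δ a c ↔ T.δ (φ a) (φ b) = T.δ (φ a) (φ c)) :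
    ∃ g ∈ Γ, ∀ a ∈ M, g a = φ a := by
  classical
  induction hk : M.card generalizing M with
  | zero =>
    rw [Finset.card_eq_zero] at hk
    subst hk
    exact ⟨1, one_mem _, by simp⟩
  | succ k ih =>
    by_cases h2 : ∃ b ∈ M, ∃ p ∈ M, b ≠ p
    · obtain ⟨b, hb, p, hp, hbp, hleaf⟩ := T.exists_leaf hM h2
      have hM' : T.MedClosed (M.erase p) := by
        intro x hx y hy z hz m h1 h2 h3
        rw [Finset.mem_erase] at hx hy hz ⊢
        refine ⟨?_, hM x hx.2 y hy.2 z hz.2 m h1 h2 h3⟩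
        rintro rfl
        have hd : ∀ s, s ≠ m → s ∈ M → T.δ m s = T.δ m b := by
          intro s hs hsM
          rcases T.tree b m s hbp with h | h
          · exact absurd (hleaf s hsM h) hs
          · exact h
        exact h1 ((hd x hx.1 hx.2).trans (hd y hy.1 hy.2).symm)
      obtain ⟨g, hg, hgM⟩ := ih (M.erase p) hM'
        (fun a ha b hb c hc => hφ a (Finset.mem_of_mem_erase ha) b (Finset.mem_of_mem_erase hb)
          c (Finset.mem_of_mem_erase hc)) (by rw [Finset.card_erase_of_mem hp, hk]; rfl)
      have hbe : b ∈ M.erase p := Finset.mem_erase.2 ⟨hbp, hb⟩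
      have hgb := hgM b hbe
      have hφinj : φ p ≠ φ b := by
        intro h
        have := (hφ b hb b hb p hp).2 (by rw [h])
        rw [T.self] at this
        exact T.ne_none hbp this.symm
      obtain ⟨f, hf, hfp, hfr⟩ := hA (g b) (g p) (φ p) (fun h => hbp (g.injective h).symm)
        (by rw [hgb]; exact hφinj)
      refine ⟨f * g, mul_mem hf hg, fun a ha => ?_⟩
      show f (g a) = φ a
      by_cases hap : a = p
      · rw [hap, hfp]
      · have hae : a ∈ M.erase p := Finset.mem_erase.2 ⟨hap, ha⟩
        rw [← hgM a hae]
        have hne : T.δ b a ≠ T.δ b p := fun h => hap (hleaf a ha h)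
        apply hfr
        · intro h
          exact hne ((hΓ hg b a p).2 h)
        · intro h
          rw [hgb, hgM a hae] at h
          exact hne ((hφ b hb a ha p hp).2 h)
    · push Not at h2
      obtain ⟨b, hb⟩ : M.Nonempty := by
        rw [← Finset.card_pos]; omega
      obtain ⟨g, hg, h⟩ := htr b (φ b)
      refine ⟨g, hg, fun a ha => ?_⟩
      rw [← h2 b hb a ha, h]

/-- The median closure of a finite set. -/
theorem exists_medClosure (F : Finset B) : ∃ M : Finset B, T.MedClosed M ∧ F ⊆ M ∧
    ∀ m ∈ M, m ∈ F ∨ ∃ x ∈ F, ∃ y ∈ F, ∃ z ∈ F,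
      T.δ m x ≠ T.δ m y ∧ T.δ m x ≠ T.δ m z ∧ T.δ m y ≠ T.δ m z := by
  classical
  let N : Set B := {m | ∃ x ∈ F, ∃ y ∈ F, ∃ z ∈ F,
      T.δ m x ≠ T.δ m y ∧ T.δ m x ≠ T.δ m z ∧ T.δ m y ≠ T.δ m z}
  have hN : N.Finite := by
    have hsub : N ⊆ ⋃ x ∈ F, ⋃ y ∈ F, ⋃ z ∈ F,
        {m | T.δ m x ≠ T.δ m y ∧ T.δ m x ≠ T.δ m z ∧ T.δ m y ≠ T.δ m z} := by
      rintro m ⟨x, hx, y, hy, z, hz, h⟩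
      simp only [Set.mem_iUnion]
      exact ⟨x, hx, y, hy, z, hz, h⟩
    refine Set.Finite.subset ?_ hsub
    refine Set.Finite.biUnion F.finite_toSet fun x _ => Set.Finite.biUnion F.finite_toSet
      fun y _ => Set.Finite.biUnion F.finite_toSet fun z _ => Set.Subsingleton.finite ?_
    rintro m ⟨h1, h2, h3⟩ m' ⟨h1', h2', h3'⟩
    by_contra hne
    have hd : ∀ s, T.δ m s ≠ T.δ m m' → T.δ m' s = T.δ m' m := fun s hs =>
      (T.tree m m' s hne).resolve_left hs
    by_cases hx : T.δ m x = T.δ m m'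
    · exact h3' ((hd y (hx ▸ h1.symm)).trans (hd z (hx ▸ h2.symm)).symm)
    · by_cases hy : T.δ m y = T.δ m m'
      · exact h2' ((hd x hx).trans (hd z (hy ▸ h3.symm)).symm)
      · exact h1' ((hd x hx).trans (hd y hy).symm)
  refine ⟨F ∪ hN.toFinset, ?_, Finset.subset_union_left, ?_⟩
  · intro x hx y hy z hz m h1 h2 h3
    by_cases hmM : m ∈ F ∪ hN.toFinset
    · exact hmM
    have hpush : ∀ x ∈ F ∪ hN.toFinset, ∃ x' ∈ F, T.δ m x' = T.δ m x := by
      intro x hx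
      have hxm : x ≠ m := by rintro rfl; exact hmM hx
      rcases Finset.mem_union.1 hx with hx | hx
      · exact ⟨x, hx, rfl⟩
      · rw [Set.Finite.mem_toFinset] at hx
        obtain ⟨a, ha, b, hb, c, hc, k1, k2, k3⟩ := hx
        by_cases h : T.δ x a = T.δ x m
        · exact ⟨b, hb, (T.tree x m b hxm).resolve_left (h ▸ k1.symm)⟩
        · exact ⟨a, ha, (T.tree x m a hxm).resolve_left h⟩
    obtain ⟨x', hx', ex⟩ := hpush x hx
    obtain ⟨y', hy', ey⟩ := hpush y hy
    obtain ⟨z', hz', ez⟩ := hpush z hz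
    refine Finset.mem_union_right _ ?_
    rw [Set.Finite.mem_toFinset]
    refine ⟨x', hx', y', hy', z', hz', ?_⟩
    rw [ex, ey, ez]; exact ⟨h1, h2, h3⟩
  · intro m hm
    rcases Finset.mem_union.1 hm with hm | hm
    · exact Or.inl hm
    · rw [Set.Finite.mem_toFinset] at hm
      exact Or.inr hm

end TreeStr
end WD
namespace WD

theorem transport {X : Type*} [TopologicalSpace X] {H₁ H₂ : Set X} (ψ : H₁ ≃ₜ H₂) {s : Set X}
    (hs : IsPreconnected s) (hsub : s ⊆ H₁) :
    ∃ s' : Set X, IsPreconnected s' ∧ ∀ x : H₁, (ψ x).1 ∈ s' ↔ x.1 ∈ s := by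
  refine ⟨Subtype.val '' (ψ '' (Subtype.val ⁻¹' s)), ?_, ?_⟩
  · have h1 : IsPreconnected (Subtype.val ⁻¹' s : Set H₁) := by
      rw [← Topology.IsInducing.subtypeVal.isPreconnected_image, Subtype.image_preimage_coe,
        Set.inter_eq_self_of_subset_right hsub]
      exact hs
    exact (h1.image _ ψ.continuous.continuousOn).image _ continuous_subtype_val.continuousOn
  · intro x
    constructor
    · rintro ⟨_, ⟨y, hy, rfl⟩, h⟩
      have := ψ.injective (Subtype.ext h)
      rw [← this]; exact hy
    · intro h
      exact ⟨_, ⟨x, h, rfl⟩, rfl⟩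

namespace TreeStr

variable {D B : Type} (T : TreeStr D B) [Fintype D]

theorem bseg_subset_U {a b c : B} (h : T.δ a b = T.δ a c) (hab : a ≠ b) :
    T.bseg b c ⊆ T.U a (T.δ a b) := by
  have := T.seg_subset_U (x := ⟨_, T.pt_mem b (T.δ b c)⟩) (y := ⟨_, T.pt_mem c (T.δ c b)⟩) (b := a)
    (by rw [T.r_pt, T.r_pt]; exact h) (by rw [T.r_pt]; exact T.ne_none hab)
  rw [T.r_pt] at this
  exact this

theorem bseg_subset_hull {F : Set T.X} {b c : B} (hb : T.br b ∈ dendriteHull T.X F)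
    (hc : T.br c ∈ dendriteHull T.X F) : T.bseg b c ⊆ dendriteHull T.X F := by
  intro x hx
  refine Set.mem_sInter.2 fun C hC => ?_
  exact T.bseg_subset hC.1 hC.2.1 (Set.mem_sInter.1 hb C hC) (Set.mem_sInter.1 hc C hC) hx

theorem dir_imp {F₁ F₂ : Set T.X} (ψ : dendriteHull T.X F₁ ≃ₜ dendriteHull T.X F₂)
    {a b c a' b' c' : B} (ha : T.br a ∈ dendriteHull T.X F₁) (hb : T.br b ∈ dendriteHull T.X F₁)
    (hc : T.br c ∈ dendriteHull T.X F₁) (ea : (ψ ⟨_, ha⟩).1 = T.br a')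
    (eb : (ψ ⟨_, hb⟩).1 = T.br b') (ec : (ψ ⟨_, hc⟩).1 = T.br c')
    (h : T.δ a b = T.δ a c) : T.δ a' b' = T.δ a' c' := by
  by_cases hab : a = b
  · subst hab
    rw [T.self] at h
    obtain rfl := (T.none_iff _ _).1 h.symm
    rw [T.br_inj (eb.symm.trans ec)]
  · obtain ⟨s', hs', hs⟩ := transport ψ (T.isPreconnected_bseg b c) (T.bseg_subset_hull hb hc)
    by_contra hne
    have h1 := (hs ⟨_, hb⟩).2 (T.left_mem_bseg b c)
    have h2 := (hs ⟨_, hc⟩).2 (T.right_mem_bseg b c)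
    rw [eb] at h1
    rw [ec] at h2
    have h3 := T.br_mem_of_preconnected hs' h1 h2 (b := a') hne
    rw [← ea] at h3
    have h4 := T.bseg_subset_U h hab ((hs _).1 h3)
    have : T.δ a a = T.δ a b := h4
    rw [T.self] at this
    exact T.ne_none hab this.symm

theorem dir_iff {F₁ F₂ : Set T.X} (ψ : dendriteHull T.X F₁ ≃ₜ dendriteHull T.X F₂)
    {a b c a' b' c' : B} (ha : T.br a ∈ dendriteHull T.X F₁) (hb : T.br b ∈ dendriteHull T.X F₁)
    (hc : T.br c ∈ dendriteHull T.X F₁) (ea : (ψ ⟨_, ha⟩).1 = T.br a')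
    (eb : (ψ ⟨_, hb⟩).1 = T.br b') (ec : (ψ ⟨_, hc⟩).1 = T.br c') :
    T.δ a b = T.δ a c ↔ T.δ a' b' = T.δ a' c' := by
  refine ⟨T.dir_imp ψ ha hb hc ea eb ec, ?_⟩
  have key : ∀ x x' (hx : T.br x ∈ dendriteHull T.X F₁) (ex : (ψ ⟨_, hx⟩).1 = T.br x'),
      ∃ hx' : T.br x' ∈ dendriteHull T.X F₂, (ψ.symm ⟨_, hx'⟩).1 = T.br x := by
    intro x x' hx ex
    refine ⟨ex ▸ (ψ ⟨_, hx⟩).2, ?_⟩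
    have : (⟨T.br x', ex ▸ (ψ ⟨_, hx⟩).2⟩ : dendriteHull T.X F₂) = ψ ⟨_, hx⟩ := Subtype.ext ex.symm
    rw [this, ψ.symm_apply_apply]
  obtain ⟨ha', ea'⟩ := key _ _ ha ea
  obtain ⟨hb', eb'⟩ := key _ _ hb eb
  obtain ⟨hc', ec'⟩ := key _ _ hc ec
  exact T.dir_imp ψ.symm ha' hb' hc' ea' eb' ec'

theorem med_br {F₁ F₂ : Set T.X} (ψ : dendriteHull T.X F₁ ≃ₜ dendriteHull T.X F₂)
    {m x y z x' y' z' : B} (hm : T.br m ∈ dendriteHull T.X F₁)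
    (hx : T.br x ∈ dendriteHull T.X F₁) (hy : T.br y ∈ dendriteHull T.X F₁)
    (hz : T.br z ∈ dendriteHull T.X F₁) (ex : (ψ ⟨_, hx⟩).1 = T.br x')
    (ey : (ψ ⟨_, hy⟩).1 = T.br y') (ez : (ψ ⟨_, hz⟩).1 = T.br z')
    (h1 : T.δ m x ≠ T.δ m y) (h2 : T.δ m x ≠ T.δ m z) (h3 : T.δ m y ≠ T.δ m z) :
    ∃ m', (ψ ⟨_, hm⟩).1 = T.br m' := by
  by_contra hno
  push Not at hno
  obtain ⟨s, hs, hws, hsub, hor⟩ := T.joined_of_three _ hno x' y' z'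
  have hsH : s ⊆ dendriteHull T.X F₂ := by
    intro w hw
    refine Set.mem_sInter.2 fun C hC => ?_
    refine hsub C hC.1 hC.2.1 ?_ ?_ ?_ hw
    · rw [← ex]; exact Set.mem_sInter.1 (ψ _).2 C hC
    · rw [← ey]; exact Set.mem_sInter.1 (ψ _).2 C hC
    · rw [← ez]; exact Set.mem_sInter.1 (ψ _).2 C hC
  obtain ⟨s', hs', hss⟩ := transport ψ.symm hs hsH
  have key : ∀ u : dendriteHull T.X F₁, u.1 ∈ s' ↔ (ψ u).1 ∈ s := by
    intro u
    have := hss (ψ u)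
    rwa [ψ.symm_apply_apply] at this
  have hms : T.br m ∉ s' := fun h => hws ((key ⟨_, hm⟩).1 h)
  have kx := key ⟨_, hx⟩
  have ky := key ⟨_, hy⟩
  have kz := key ⟨_, hz⟩
  rw [ex] at kx
  rw [ey] at ky
  rw [ez] at kz
  rcases hor with ⟨u, v⟩ | ⟨u, v⟩ | ⟨u, v⟩
  · exact hms (T.br_mem_of_preconnected hs' (kx.2 u) (ky.2 v) h1)
  · exact hms (T.br_mem_of_preconnected hs' (kx.2 u) (kz.2 v) h2)
  · exact hms (T.br_mem_of_preconnected hs' (ky.2 u) (kz.2 v) h3)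

/-- The group `G` realises all homeomorphisms between hulls of finite sets. -/
theorem psi_part (G : Subgroup (T.X ≃ₜ T.X))
    (hG : ∀ (M : Finset B) (_ : T.MedClosed M) (φ : B → B)
      (_ : ∀ a ∈ M, ∀ b ∈ M, ∀ c ∈ M, T.δ a b = T.δ a c ↔ T.δ (φ a) (φ b) = T.δ (φ a) (φ c)),
      ∃ h ∈ G, ∀ a ∈ M, h (T.br a) = T.br (φ a))
    (F₁ F₂ : Set T.X) (hF₁ : F₁.Finite) (hb₁ : ∀ p ∈ F₁, ∃ b, p = T.br b)
    (hb₂ : ∀ p ∈ F₂, ∃ b, p = T.br b) (ψ : dendriteHull T.X F₁ ≃ₜ dendriteHull T.X F₂)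
    (hψ : Subtype.val '' (ψ '' (Subtype.val ⁻¹' F₁)) = F₂) :
    ∃ g ∈ G, ∀ (p : T.X) (hp : p ∈ F₁), (g : T.X ≃ₜ T.X) p = (ψ ⟨p, subset_dendriteHull hp⟩ : T.X) := by
  classical
  have hfin : (T.br ⁻¹' F₁).Finite := hF₁.preimage (fun a _ b _ h => T.br_inj h)
  obtain ⟨M, hM, hFM, hMF⟩ := T.exists_medClosure hfin.toFinset
  have hmemF : ∀ x, x ∈ hfin.toFinset → T.br x ∈ F₁ := fun x hx => by
    rw [Set.Finite.mem_toFinset] at hx; exact hx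
  have hhull : ∀ m ∈ M, T.br m ∈ dendriteHull T.X F₁ := by
    intro m hm
    rcases hMF m hm with h | ⟨x, hx, y, hy, z, hz, h1, h2, h3⟩
    · exact subset_dendriteHull (hmemF m h)
    · refine Set.mem_sInter.2 fun C hC => ?_
      exact T.br_mem_of_preconnected hC.2.1 (hC.2.2 (hmemF x hx)) (hC.2.2 (hmemF y hy)) h1
  have himF : ∀ x (hx : T.br x ∈ F₁) (hx' : T.br x ∈ dendriteHull T.X F₁), ∃ x', (ψ ⟨_, hx'⟩).1 = T.br x' := by
    intro x hx hx'
    apply hb₂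
    exact hψ.subset ⟨_, ⟨⟨_, hx'⟩, hx, rfl⟩, rfl⟩
  have him : ∀ m (hm : m ∈ M), ∃ m', (ψ ⟨_, hhull m hm⟩).1 = T.br m' := by
    intro m hm
    rcases hMF m hm with h | ⟨x, hx, y, hy, z, hz, h1, h2, h3⟩
    · exact himF m (hmemF m h) _
    · obtain ⟨x', ex⟩ := himF x (hmemF x hx) (hhull x (hFM hx))
      obtain ⟨y', ey⟩ := himF y (hmemF y hy) (hhull y (hFM hy))
      obtain ⟨z', ez⟩ := himF z (hmemF z hz) (hhull z (hFM hz))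
      exact T.med_br ψ (hhull m hm) _ _ _ ex ey ez h1 h2 h3
  choose φ hφ using him
  let φ' : B → B := fun m => if hm : m ∈ M then φ m hm else m
  have hφ' : ∀ m (hm : m ∈ M), (ψ ⟨_, hhull m hm⟩).1 = T.br (φ' m) := by
    intro m hm
    simp only [φ', dif_pos hm]
    exact hφ m hm
  obtain ⟨g, hg, hgM⟩ := hG M hM φ' (fun a ha b hb c hc =>
    T.dir_iff ψ (hhull a ha) (hhull b hb) (hhull c hc) (hφ' a ha) (hφ' b hb) (hφ' c hc))
  refine ⟨g, hg, fun p hp => ?_⟩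
  obtain ⟨b, rfl⟩ := hb₁ p hp
  have hbM : b ∈ M := hFM (by rw [Set.Finite.mem_toFinset]; exact hp)
  rw [hgM b hbM, ← hφ' b hbM]

theorem hull_image {X : Type*} [TopologicalSpace X] (h : X ≃ₜ X) (F : Set X) :
    h '' dendriteHull X F = dendriteHull X (h '' F) := by
  have sub : ∀ (h : X ≃ₜ X) (F : Set X), h '' dendriteHull X F ⊆ dendriteHull X (h '' F) := by
    rintro h F _ ⟨x, hx, rfl⟩
    refine Set.mem_sInter.2 fun C hC => ?_
    refine Set.mem_sInter.1 hx (h ⁻¹' C) ⟨hC.1.preimage h.continuous, ?_, ?_⟩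
    · exact h.isPreconnected_preimage.2 hC.2.1
    · exact Set.image_subset_iff.1 hC.2.2
  refine Set.Subset.antisymm (sub h F) ?_
  have := Set.image_mono (f := h) (sub h.symm (h '' F))
  rwa [← Set.image_comp, ← Set.image_comp, Homeomorph.symm_comp_self, Homeomorph.self_comp_symm,
    Set.image_id, Set.image_id] at this

theorem ptOrder_homeo {X : Type*} [TopologicalSpace X] (h : X ≃ₜ X) (p : X) :
    ptOrder X (h p) = ptOrder X p := by
  have : setComponents X {h p}ᶜ = (fun s => h '' s) '' setComponents X {p}ᶜ := by
    have hc : ({h p}ᶜ : Set X) = h '' {p}ᶜ := by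
      rw [Set.image_compl_eq h.bijective, Set.image_singleton]
    ext C
    constructor
    · rintro ⟨x, hx, rfl⟩
      rw [hc] at hx
      obtain ⟨y, hy, rfl⟩ := hx
      refine ⟨_, ⟨y, hy, rfl⟩, ?_⟩
      rw [hc]
      exact h.image_connectedComponentIn hy
    · rintro ⟨_, ⟨y, hy, rfl⟩, rfl⟩
      refine ⟨h y, by rw [hc]; exact ⟨y, hy, rfl⟩, ?_⟩
      rw [hc]
      exact h.image_connectedComponentIn hy
  unfold ptOrder
  rw [this, Set.ncard_image_of_injective _ h.injective.image_injective]

theorem homeo_br [Nonempty B] (hD : 3 ≤ Fintype.card D) (h : T.X ≃ₜ T.X) (b : B) :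
    ∃ c, h (T.br b) = T.br c :=
  T.eq_br_of_ptOrder hD (by rw [ptOrder_homeo, T.ptOrder_br])

/-- Basic open subsets of the homeomorphism group contain pointwise stabilisers. -/
theorem nhd_finite [Nonempty B] (hD : 3 ≤ Fintype.card D) (h : T.X ≃ₜ T.X)
    {O : Set T.X} (hO : IsOpen O) {x : T.X} (hx : h x ∈ O) :
    ∃ V ∈ 𝓝 x, ∃ F : Finset B, ∀ g : T.X ≃ₜ T.X, (∀ b ∈ F, g (T.br b) = h (T.br b)) →
      ∀ y ∈ V, g y ∈ O := by
  classical
  induction hO with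
  | basic s hs =>
    obtain ⟨f, i, rfl⟩ := hs
    obtain ⟨p, hp⟩ := T.homeo_br hD h.symm f
    have hp' : h (T.br p) = T.br f := by rw [← hp, h.apply_symm_apply]
    have hxp : x.1 p ≠ none := by
      intro hn
      rw [T.eq_br_of_none hn, hp'] at hx
      have : T.δ f f = some i := hx
      rw [T.self] at this
      cases this
    obtain ⟨q, hq⟩ := T.exists_dir p (x.1 p)
    refine ⟨T.U p (x.1 p), (T.isOpen_U p hxp).mem_nhds rfl, {p, q}, fun g hg => ?_⟩
    have hgp := hg p (by simp)
    have hgq := hg q (by simp)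
    have himg : ∀ k : T.X ≃ₜ T.X, k (T.br p) = T.br f → ∀ u ∈ T.U p (x.1 p), ∀ v ∈ T.U p (x.1 p),
        (k u).1 f = (k v).1 f := by
      intro k hk u hu v hv
      have hpre := (T.isPreconnected_U p hxp).image k k.continuous.continuousOn
      refine (T.subset_U_of_preconnected hpre ?_ (x := k v) ⟨v, hv, rfl⟩ ⟨u, hu, rfl⟩)
      rintro ⟨w, hw, hwf⟩
      rw [← hk] at hwf
      rw [k.injective hwf] at hw
      have : T.δ p p = x.1 p := hw
      rw [T.self] at this
      exact hxp this.symm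
    intro y hy
    have h1 := himg g (hgp.trans hp') y hy (T.br q) hq
    have h2 := himg h hp' x rfl (T.br q) hq
    show (g y).1 f = some i
    rw [h1, hgq, ← h2]
    exact hx
  | univ => exact ⟨Set.univ, Filter.univ_mem, ∅, fun _ _ _ _ => trivial⟩
  | inter s t _ _ ihs iht =>
    obtain ⟨V, hV, F, h1⟩ := ihs hx.1
    obtain ⟨V', hV', F', h2⟩ := iht hx.2
    refine ⟨V ∩ V', Filter.inter_mem hV hV', F ∪ F', fun g hg y hy => ⟨?_, ?_⟩⟩
    · exact h1 g (fun b hb => hg b (Finset.mem_union_left _ hb)) y hy.1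
    · exact h2 g (fun b hb => hg b (Finset.mem_union_right _ hb)) y hy.2
  | sUnion S _ ih =>
    obtain ⟨s, hs, hxs⟩ := hx
    obtain ⟨V, hV, F, h1⟩ := ih s hs hxs
    exact ⟨V, hV, F, fun g hg y hy => ⟨s, hs, h1 g hg y hy⟩⟩

theorem nhd_compact [Nonempty B] (hD : 3 ≤ Fintype.card D) (h : T.X ≃ₜ T.X)
    {K O : Set T.X} (hK : IsCompact K) (hO : IsOpen O) (hKO : Set.MapsTo h K O) :
    ∃ F : Finset B, ∀ g : T.X ≃ₜ T.X, (∀ b ∈ F, g (T.br b) = h (T.br b)) → Set.MapsTo g K O := by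
  classical
  refine hK.induction_on (p := fun K => ∃ F : Finset B, ∀ g : T.X ≃ₜ T.X,
    (∀ b ∈ F, g (T.br b) = h (T.br b)) → Set.MapsTo g K O) ?_ ?_ ?_ ?_
  · exact ⟨∅, fun _ _ _ hx => hx.elim⟩
  · rintro s t hst ⟨F, hF⟩
    exact ⟨F, fun g hg => (hF g hg).mono_left hst⟩
  · rintro s t ⟨F, hF⟩ ⟨F', hF'⟩
    refine ⟨F ∪ F', fun g hg => ?_⟩
    rintro x (hx | hx)
    · exact hF g (fun b hb => hg b (Finset.mem_union_left _ hb)) hx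
    · exact hF' g (fun b hb => hg b (Finset.mem_union_right _ hb)) hx
  · intro x hx
    obtain ⟨V, hV, F, hF⟩ := T.nhd_finite hD h hO (hKO hx)
    exact ⟨V, mem_nhdsWithin_of_mem_nhds hV, F, fun g hg y hy => hF g hg y hy⟩

theorem nhd_open [Nonempty B] (hD : 3 ≤ Fintype.card D) (h : T.X ≃ₜ T.X)
    {O : Set C(T.X, T.X)} (hO : IsOpen O) (hh : (h : C(T.X, T.X)) ∈ O) :
    ∃ F : Finset B, ∀ g : T.X ≃ₜ T.X, (∀ b ∈ F, g (T.br b) = h (T.br b)) →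
      (g : C(T.X, T.X)) ∈ O := by
  classical
  induction hO with
  | basic s hs =>
    obtain ⟨K, hK, U, hU, rfl⟩ := hs
    exact T.nhd_compact hD h hK hU hh
  | univ => exact ⟨∅, fun _ _ => trivial⟩
  | inter s t _ _ ihs iht =>
    obtain ⟨F, h1⟩ := ihs hh.1
    obtain ⟨F', h2⟩ := iht hh.2
    refine ⟨F ∪ F', fun g hg => ⟨?_, ?_⟩⟩
    · exact h1 g (fun b hb => hg b (Finset.mem_union_left _ hb))
    · exact h2 g (fun b hb => hg b (Finset.mem_union_right _ hb))
  | sUnion S _ ih =>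
    obtain ⟨s, hs, hxs⟩ := hh
    obtain ⟨F, h1⟩ := ih s hs hxs
    exact ⟨F, fun g hg => ⟨s, hs, h1 g hg⟩⟩

/-- The final abstract theorem. -/
theorem final [Nonempty B] [Countable B] (hD : 3 ≤ Fintype.card D)
    (S : Set (Equiv.Perm B)) (hS : S.Finite) (hAut : ∀ g ∈ S, T.IsAut g)
    (htr : ∀ a b : B, ∃ g ∈ Subgroup.closure S, g a = b)
    (hA : ∀ b p p' : B, p ≠ b → p' ≠ b → ∃ g ∈ Subgroup.closure S, g p = p' ∧
      ∀ r, T.δ b r ≠ T.δ b p → T.δ b r ≠ T.δ b p' → g r = r) :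
    ∃ (X : Type) (_ : TopologicalSpace X) (_ : IsWazewskiDendrite (Fintype.card D) X)
      (G : Subgroup (X ≃ₜ X)),
      G.FG ∧ Dense (G : Set (X ≃ₜ X)) ∧
      ∀ F₁ F₂ : Set X, F₁.Finite → F₂.Finite →
        (∀ p ∈ F₁, ptOrder X p = Fintype.card D) → (∀ p ∈ F₂, ptOrder X p = Fintype.card D) →
        ∀ ψ : dendriteHull X F₁ ≃ₜ dendriteHull X F₂,
          Subtype.val '' (⇑ψ '' (Subtype.val ⁻¹' F₁)) = F₂ →
          ∃ g ∈ G, ∀ (p : X) (hp : p ∈ F₁),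
            (g : X ≃ₜ X) p = (ψ ⟨p, subset_dendriteHull hp⟩ : X) := by
  classical
  obtain ⟨G, hfg, hlift⟩ := T.lift_group S hS hAut
  have hG : ∀ (M : Finset B) (_ : T.MedClosed M) (φ : B → B)
      (_ : ∀ a ∈ M, ∀ b ∈ M, ∀ c ∈ M, T.δ a b = T.δ a c ↔ T.δ (φ a) (φ b) = T.δ (φ a) (φ c)),
      ∃ h ∈ G, ∀ a ∈ M, h (T.br a) = T.br (φ a) := by
    intro M hM φ hφ
    obtain ⟨g, hg, hgM⟩ := T.homog (Subgroup.closure S) ((Subgroup.closure_le _).2 hAut) htr hA M hM φ hφ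
    obtain ⟨h, hh, hb⟩ := hlift g hg
    exact ⟨h, hh, fun a ha => by rw [hb, hgM a ha]⟩
  refine ⟨T.X, inferInstance, T.isWazewski rfl, G, hfg, ?_, ?_⟩
  · intro h
    rw [mem_closure_iff]
    rintro _ ⟨O, hO, rfl⟩ hh
    obtain ⟨F, hF⟩ := T.nhd_open hD h hO hh
    let ψ : dendriteHull T.X (T.br '' F) ≃ₜ dendriteHull T.X (h '' (T.br '' F)) :=
      (h.image _).trans (Homeomorph.setCongr (hull_image h _))
    obtain ⟨g, hg, hgF⟩ := T.psi_part G hG (T.br '' F) (h '' (T.br '' F)) (F.finite_toSet.image _)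
      (by rintro _ ⟨b, -, rfl⟩; exact ⟨b, rfl⟩)
      (by rintro _ ⟨_, ⟨b, -, rfl⟩, rfl⟩; exact T.homeo_br hD h b) ψ (by
        ext y
        constructor
        · rintro ⟨_, ⟨x, hx, rfl⟩, rfl⟩
          exact ⟨x.1, hx, rfl⟩
        · rintro ⟨x, hx, rfl⟩
          exact ⟨_, ⟨⟨x, subset_dendriteHull hx⟩, hx, rfl⟩, rfl⟩)
    refine ⟨g, hF g fun b hb => ?_, hg⟩
    exact hgF (T.br b) ⟨b, hb, rfl⟩
  · intro F₁ F₂ h1 h2 hb1 hb2 ψ hψ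
    exact T.psi_part G hG F₁ F₂ h1 (fun p hp => T.eq_br_of_ptOrder hD (hb1 p hp))
      (fun p hp => T.eq_br_of_ptOrder hD (hb2 p hp)) ψ hψ

end TreeStr
end WD
namespace WD

/-- Directions: down, up, and `m` side directions. -/
abbrev Dir (m : ℕ) : Type := Bool ⊕ Fin m

/-- Branch points of the model. -/
abbrev Br (m : ℕ) : Type := ℚ × List (Fin m × ℚ)

namespace Model

variable {m : ℕ}

/-- down -/
def dn : Option (Dir m) := some (Sum.inl false)
/-- up -/
def up : Option (Dir m) := some (Sum.inl true)
/-- side -/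
def sd (i : Fin m) : Option (Dir m) := some (Sum.inr i)

theorem dn_ne_none : (dn : Option (Dir m)) ≠ none := by simp [dn]
theorem up_ne_none : (up : Option (Dir m)) ≠ none := by simp [up]
theorem sd_ne_none (i : Fin m) : sd i ≠ none := by simp [sd]
theorem dn_ne_up : (dn : Option (Dir m)) ≠ up := by simp [dn, up]
theorem dn_ne_sd (i : Fin m) : dn ≠ sd i := by simp [dn, sd]
theorem up_ne_sd (i : Fin m) : up ≠ sd i := by simp [up, sd]
theorem sd_inj {i j : Fin m} : sd i = sd j ↔ i = j := by simp [sd]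

/-- Head direction. -/
def hd : List (Fin m × ℚ) → Option (Dir m)
  | [] => none
  | x :: _ => sd x.1

/-- The direction function. -/
def dl : List (Fin m × ℚ) → ℚ → ℚ → List (Fin m × ℚ) → Option (Dir m)
  | [], q, q', l' => if q' < q then dn else if q < q' then up else hd l'
  | x :: t, q, q', l' =>
    if q = q' then
      match l' with
      | [] => dn
      | y :: t' => if x.1 = y.1 then dl t x.2 y.2 t' else dn
    else dn

/-- The direction function on points. -/
def dd (a b : Br m) : Option (Dir m) := dl a.2 a.1 b.1 b.2

theorem dd_lt {q q' : ℚ} (l l' : List (Fin m × ℚ)) (h : q' < q) : dd (q, l) (q', l') = dn := by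
  cases l with
  | nil => simp [dd, dl, h]
  | cons x t => simp [dd, dl, h.ne']

theorem dd_gt {q q' : ℚ} (l' : List (Fin m × ℚ)) (h : q < q') : dd (q, []) (q', l') = up := by
  simp [dd, dl, h, h.not_gt]

theorem dd_cons_ne {q q' : ℚ} (x) (t l' : List (Fin m × ℚ)) (h : q ≠ q') :
    dd (q, x :: t) (q', l') = dn := by
  simp [dd, dl, h]

theorem dd_nil (q : ℚ) (l' : List (Fin m × ℚ)) : dd (q, []) (q, l') = hd l' := by
  simp [dd, dl]

theorem dd_cons_nil (q : ℚ) (x) (t : List (Fin m × ℚ)) : dd (q, x :: t) (q, []) = dn := by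
  simp [dd, dl]

theorem dd_cons_ne' (q : ℚ) {i j : Fin m} (r s : ℚ) (t t' : List (Fin m × ℚ)) (h : i ≠ j) :
    dd (q, (i, r) :: t) (q, (j, s) :: t') = dn := by
  simp [dd, dl, h]

theorem dd_cons (q : ℚ) (i : Fin m) (r s : ℚ) (t t' : List (Fin m × ℚ)) :
    dd (q, (i, r) :: t) (q, (i, s) :: t') = dd (r, t) (s, t') := by
  simp [dd, dl]

theorem dd_hd_ne (q : ℚ) (i : Fin m) (r : ℚ) (t l' : List (Fin m × ℚ)) (h : hd l' ≠ sd i) :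
    dd (q, (i, r) :: t) (q, l') = dn := by
  cases l' with
  | nil => exact dd_cons_nil _ _ _
  | cons y t' => exact dd_cons_ne' _ _ _ _ _ (fun h' => h (by simp [hd, h']))

theorem hd_ne_dn (l : List (Fin m × ℚ)) : hd l ≠ dn := by
  cases l with
  | nil => exact dn_ne_none.symm
  | cons x t => exact (dn_ne_sd _).symm

theorem hd_ne_up (l : List (Fin m × ℚ)) : hd l ≠ up := by
  cases l with
  | nil => exact up_ne_none.symm
  | cons x t => exact (up_ne_sd _).symm

theorem hd_none {l : List (Fin m × ℚ)} (h : hd l = none) : l = [] := by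
  cases l with
  | nil => rfl
  | cons x t => exact absurd h (sd_ne_none _)

theorem dd_none (l : List (Fin m × ℚ)) : ∀ (q q' : ℚ) (l' : List (Fin m × ℚ)),
    dd (q, l) (q', l') = none ↔ (q, l) = (q', l') := by
  induction l with
  | nil =>
    intro q q' l'
    rcases lt_trichotomy q q' with h | rfl | h
    · rw [dd_gt _ h]; simp [up_ne_none, h.ne]
    · rw [dd_nil]
      cases l' <;> simp [hd, sd]
    · rw [dd_lt _ _ h]; simp [dn_ne_none, h.ne']
  | cons x t ih =>
    intro q q' l'
    obtain ⟨i, r⟩ := x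
    by_cases h : q = q'
    · subst h
      match l' with
      | [] => rw [dd_cons_nil]; simp [dn_ne_none]
      | (j, s) :: t' =>
        by_cases hij : i = j
        · subst hij
          rw [dd_cons, ih]; simp
        · rw [dd_cons_ne' _ _ _ _ _ hij]; simp [dn_ne_none, hij]
    · rw [dd_cons_ne _ _ _ h]; simp [dn_ne_none, h]

theorem dn_or (l : List (Fin m × ℚ)) : ∀ (q q' : ℚ) (l' : List (Fin m × ℚ)),
    (q, l) ≠ (q', l') → dd (q, l) (q', l') = dn ∨ dd (q', l') (q, l) = dn := by
  induction l with
  | nil =>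
    intro q q' l' hne
    rcases lt_trichotomy q q' with h | rfl | h
    · right; exact dd_lt _ _ h
    · right
      cases l' with
      | nil => exact absurd rfl hne
      | cons y t' => exact dd_cons_nil _ _ _
    · left; exact dd_lt _ _ h
  | cons x t ih =>
    intro q q' l' hne
    obtain ⟨i, r⟩ := x
    by_cases h : q = q'
    · subst h
      match l' with
      | [] => left; rw [dd_cons_nil]
      | (j, s) :: t' =>
        by_cases hij : i = j
        · subst hij
          rw [dd_cons, dd_cons]
          apply ih
          rintro h
          apply hne
          simp_all
        · left; rw [dd_cons_ne' _ _ _ _ _ hij]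
    · left; rw [dd_cons_ne _ _ _ h]

theorem tree_lt {q q' : ℚ} (l l' : List (Fin m × ℚ)) (s : ℚ) (u : List (Fin m × ℚ)) (h : q < q') :
    dd (q, l) (s, u) = dd (q, l) (q', l') ∨ dd (q', l') (s, u) = dd (q', l') (q, l) := by
  rcases le_or_gt s q with hs | hs
  · right; rw [dd_lt _ _ (hs.trans_lt h), dd_lt _ _ h]
  · left
    cases l with
    | nil => rw [dd_gt _ h, dd_gt _ hs]
    | cons x t => rw [dd_cons_ne _ _ _ h.ne, dd_cons_ne _ _ _ hs.ne]

theorem dd_tree (l : List (Fin m × ℚ)) : ∀ (q q' : ℚ) (l' : List (Fin m × ℚ)) (s : ℚ)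
    (u : List (Fin m × ℚ)), (q, l) ≠ (q', l') →
    dd (q, l) (s, u) = dd (q, l) (q', l') ∨ dd (q', l') (s, u) = dd (q', l') (q, l) := by
  induction l with
  | nil =>
    intro q q' l' s u hne
    rcases lt_trichotomy q q' with h | rfl | h
    · exact tree_lt _ _ _ _ h
    · match l' with
      | [] => exact absurd rfl hne
      | (j, r) :: t' =>
        rw [dd_nil, dd_cons_nil]
        by_cases hs : q = s
        · subst hs
          by_cases hu : hd u = sd j
          · left; rw [dd_nil, hu]; rfl
          · right; exact dd_hd_ne _ _ _ _ _ hu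
        · right; exact dd_cons_ne _ _ _ hs
    · exact (tree_lt _ _ _ _ h).symm
  | cons x t ih =>
    intro q q' l' s u hne
    obtain ⟨i, r⟩ := x
    rcases lt_trichotomy q q' with h | rfl | h
    · exact tree_lt _ _ _ _ h
    · by_cases hs : q = s
      · subst hs
        match l' with
        | [] =>
          rw [dd_nil, dd_cons_nil]
          by_cases hu : hd u = sd i
          · right; rw [dd_nil, hu]; rfl
          · left; exact dd_hd_ne _ _ _ _ _ hu
        | (j, w) :: t' =>
          by_cases hij : i = j
          · subst hij
            by_cases hu : hd u = sd i
            · match u with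
              | [] => exact absurd hu.symm (sd_ne_none _)
              | (k, v) :: u' =>
                obtain rfl : k = i := sd_inj.1 hu
                rw [dd_cons, dd_cons, dd_cons, dd_cons]
                apply ih
                rintro h; apply hne; simp_all
            · rw [dd_hd_ne _ _ _ _ _ hu, dd_hd_ne _ _ _ _ _ hu]
              rcases dn_or _ _ _ _ hne with h | h
              · left; exact h.symm
              · right; exact h.symm
          · rw [dd_cons_ne' _ _ _ _ _ hij, dd_cons_ne' _ _ _ _ _ (Ne.symm hij)]
            by_cases hu : hd u = sd i
            · right
              exact dd_hd_ne _ _ _ _ _ (fun h => hij (sd_inj.1 (hu.symm.trans h)))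
            · left; exact dd_hd_ne _ _ _ _ _ hu
      · rw [dd_cons_ne _ _ _ hs]
        match l' with
        | [] => left; rw [dd_cons_nil]
        | (j, w) :: t' =>
          rw [dd_cons_ne _ _ _ hs]
          rcases dn_or _ _ _ _ hne with h | h
          · left; exact h.symm
          · right; exact h.symm
    · exact (tree_lt _ _ _ _ h).symm

theorem dense_lt {q q' : ℚ} (l l' : List (Fin m × ℚ)) (h : q < q') :
    ∃ c : Br m, c ≠ (q, l) ∧ c ≠ (q', l') ∧ dd c (q, l) ≠ dd c (q', l') := by
  obtain ⟨s, h1, h2⟩ := exists_between h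
  refine ⟨(s, []), ?_, ?_, ?_⟩
  · simp [h1.ne']
  · simp [h2.ne]
  · rw [dd_lt _ _ h1, dd_gt _ h2]; exact dn_ne_up

theorem dense_nil (q : ℚ) (l' : List (Fin m × ℚ)) (h : l' ≠ []) :
    ∃ c : Br m, c ≠ (q, []) ∧ c ≠ (q, l') ∧ dd c (q, []) ≠ dd c (q, l') := by
  match l' with
  | [] => exact absurd rfl h
  | (j, r) :: t' =>
    refine ⟨(q, [(j, r - 1)]), by simp, ?_, ?_⟩
    · simp
    · rw [dd_cons_nil, dd_cons, dd_gt _ (by linarith)]; exact dn_ne_up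

theorem dd_dense (l : List (Fin m × ℚ)) : ∀ (q q' : ℚ) (l' : List (Fin m × ℚ)),
    (q, l) ≠ (q', l') →
    ∃ c : Br m, c ≠ (q, l) ∧ c ≠ (q', l') ∧ dd c (q, l) ≠ dd c (q', l') := by
  induction l with
  | nil =>
    intro q q' l' hne
    rcases lt_trichotomy q q' with h | rfl | h
    · exact dense_lt _ _ h
    · exact dense_nil _ _ (fun h => hne (by rw [h]))
    · obtain ⟨c, h1, h2, h3⟩ := dense_lt l' [] h
      exact ⟨c, h2, h1, h3.symm⟩
  | cons x t ih =>
    intro q q' l' hne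
    obtain ⟨i, r⟩ := x
    rcases lt_trichotomy q q' with h | rfl | h
    · exact dense_lt _ _ h
    · match l' with
      | [] =>
        obtain ⟨c, h1, h2, h3⟩ := dense_nil q ((i, r) :: t) (by simp)
        exact ⟨c, h2, h1, h3.symm⟩
      | (j, s) :: t' =>
        by_cases hij : i = j
        · subst hij
          obtain ⟨⟨c, u⟩, h1, h2, h3⟩ := ih r s t' (by rintro h; apply hne; simp_all)
          refine ⟨(q, (i, c) :: u), ?_, ?_, ?_⟩
          · intro h; apply h1; simp_all
          · intro h; apply h2; simp_all
          · rw [dd_cons, dd_cons]; exact h3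
        · refine ⟨(q, []), by simp, by simp, ?_⟩
          rw [dd_nil, dd_nil]
          exact fun h => hij (sd_inj.1 h)
    · obtain ⟨c, h1, h2, h3⟩ := dense_lt l' ((i, r) :: t) h
      exact ⟨c, h2, h1, h3.symm⟩

theorem dd_surj (l : List (Fin m × ℚ)) : ∀ (q : ℚ) (d : Dir m),
    ∃ p : Br m, dd (q, l) p = some d := by
  induction l with
  | nil =>
    intro q d
    match d with
    | Sum.inl false => exact ⟨(q - 1, []), dd_lt _ _ (by linarith)⟩
    | Sum.inl true => exact ⟨(q + 1, []), dd_gt _ (by linarith)⟩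
    | Sum.inr i => exact ⟨(q, [(i, 0)]), dd_nil _ _⟩
  | cons x t ih =>
    intro q d
    obtain ⟨i, r⟩ := x
    obtain ⟨⟨s, u⟩, h⟩ := ih r d
    exact ⟨(q, (i, s) :: u), by rw [dd_cons, h]⟩

theorem meet_lt {q q' : ℚ} (l l' : List (Fin m × ℚ)) (h : q < q') :
    ∃ c : Br m, dd c (q, l) ≠ dd c (q', l') ∧ dd c (q, l) ≠ dn ∧ dd c (q', l') ≠ dn := by
  refine ⟨(q, []), ?_⟩
  rw [dd_nil, dd_gt _ h]
  exact ⟨hd_ne_up _, hd_ne_dn _, dn_ne_up.symm⟩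

theorem meet_hd (q : ℚ) (l l' : List (Fin m × ℚ)) (h : hd l ≠ hd l') :
    ∃ c : Br m, dd c (q, l) ≠ dd c (q, l') ∧ dd c (q, l) ≠ dn ∧ dd c (q, l') ≠ dn := by
  refine ⟨(q, []), ?_⟩
  rw [dd_nil, dd_nil]
  exact ⟨h, hd_ne_dn _, hd_ne_dn _⟩

theorem dd_meet (l : List (Fin m × ℚ)) : ∀ (q q' : ℚ) (l' : List (Fin m × ℚ)),
    (q, l) ≠ (q', l') →
    ∃ c : Br m, dd c (q, l) ≠ dd c (q', l') ∧ dd c (q, l) ≠ dn ∧ dd c (q', l') ≠ dn := by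
  induction l with
  | nil =>
    intro q q' l' hne
    rcases lt_trichotomy q q' with h | rfl | h
    · exact meet_lt _ _ h
    · exact meet_hd _ _ _ (fun h => hne (by rw [hd_none h.symm]))
    · obtain ⟨c, h1, h2, h3⟩ := meet_lt l' [] h
      exact ⟨c, h1.symm, h3, h2⟩
  | cons x t ih =>
    intro q q' l' hne
    obtain ⟨i, r⟩ := x
    rcases lt_trichotomy q q' with h | rfl | h
    · exact meet_lt _ _ h
    · by_cases hh : hd ((i, r) :: t) = hd l'
      · match l' with
        | [] => exact absurd hh (sd_ne_none _)
        | (j, s) :: t' =>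
          obtain rfl : i = j := sd_inj.1 hh
          obtain ⟨⟨c, u⟩, h⟩ := ih r s t' (by rintro h; apply hne; simp_all)
          exact ⟨(q, (i, c) :: u), by rw [dd_cons, dd_cons]; exact h⟩
      · exact meet_hd _ _ _ hh
    · obtain ⟨c, h1, h2, h3⟩ := meet_lt l' ((i, r) :: t) h
      exact ⟨c, h1.symm, h3, h2⟩

/-- The median property. -/
def HasMed (a b c : Br m) : Prop :=
  ∃ p : Br m, dd p a ≠ dd p b ∧ dd p a ≠ dd p c ∧ dd p b ≠ dd p c

theorem HasMed.rot {a b c : Br m} (h : HasMed a b c) : HasMed b c a := by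
  obtain ⟨p, h1, h2, h3⟩ := h
  exact ⟨p, h3, h1.symm, h2.symm⟩

theorem HasMed.swap {a b c : Br m} (h : HasMed a b c) : HasMed b a c := by
  obtain ⟨p, h1, h2, h3⟩ := h
  exact ⟨p, h1.symm, h3, h2⟩

theorem med_same_hd (q : ℚ) (l l' : List (Fin m × ℚ)) (c : Br m) (hne : l ≠ l')
    (hh : hd l = hd l') (hc : c.1 ≠ q ∨ hd c.2 ≠ hd l) : HasMed (q, l) (q, l') c := by
  obtain ⟨s, u⟩ := c
  match l, l' with
  | [], [] => exact absurd rfl hne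
  | [], y :: t => exact absurd hh.symm (sd_ne_none _)
  | x :: t, [] => exact absurd hh (sd_ne_none _)
  | (i, r) :: t, (j, w) :: t' =>
    obtain rfl : i = j := sd_inj.1 hh
    obtain ⟨⟨p, v⟩, h1, h2, h3⟩ := dd_meet t r w t' (by rintro h; apply hne; simp_all)
    refine ⟨(q, (i, p) :: v), ?_⟩
    have hdn : dd (q, (i, p) :: v) (s, u) = dn := by
      by_cases hs : q = s
      · subst hs
        rcases hc with hc | hc
        · exact absurd rfl hc
        · exact dd_hd_ne _ _ _ _ _ hc
      · exact dd_cons_ne _ _ _ hs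
    rw [dd_cons, dd_cons, hdn]
    exact ⟨h1, h2, h3⟩

theorem med_two (q : ℚ) (l l' : List (Fin m × ℚ)) (c : Br m) (hne : l ≠ l')
    (hc : c.1 ≠ q) : HasMed (q, l) (q, l') c := by
  by_cases hh : hd l = hd l'
  · exact med_same_hd q l l' c hne hh (Or.inl hc)
  · obtain ⟨s, u⟩ := c
    refine ⟨(q, []), ?_⟩
    rw [dd_nil, dd_nil]
    refine ⟨hh, ?_⟩
    rcases lt_or_gt_of_ne hc with h | h
    · rw [dd_lt _ _ h]; exact ⟨hd_ne_dn _, hd_ne_dn _⟩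
    · rw [dd_gt _ h]; exact ⟨hd_ne_up _, hd_ne_up _⟩

theorem med_lt {a b c : Br m} (h : a.1 < b.1) (h' : b.1 < c.1) : HasMed a b c := by
  obtain ⟨q, l⟩ := a
  obtain ⟨q', l'⟩ := b
  obtain ⟨s, u⟩ := c
  refine ⟨(q', []), ?_⟩
  rw [dd_nil, dd_lt _ _ h, dd_gt _ h']
  exact ⟨(hd_ne_dn _).symm, dn_ne_up, hd_ne_up _⟩

theorem dd_med (l : List (Fin m × ℚ)) : ∀ (q : ℚ) (b c : Br m),
    (q, l) ≠ b → (q, l) ≠ c → b ≠ c → HasMed (q, l) b c := by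
  have red : ∀ (l : List (Fin m × ℚ)) (q : ℚ) (b c : Br m),
      (q, l) ≠ b → (q, l) ≠ c → b ≠ c →
      (∀ i r t s t' w u, l = (i, r) :: t → b = (q, (i, s) :: t') → c = (q, (i, w) :: u) →
        HasMed (q, l) b c) → HasMed (q, l) b c := by
    rintro l q ⟨q', l'⟩ ⟨s, u⟩ h1 h2 h3 hrec
    by_cases e1 : q = q'
    · subst e1
      by_cases e2 : q = s
      · subst e2
        have n1 : l ≠ l' := fun h => h1 (by rw [h])
        have n2 : l ≠ u := fun h => h2 (by rw [h])
        have n3 : l' ≠ u := fun h => h3 (by rw [h])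
        by_cases d1 : hd l = hd l'
        · by_cases d2 : hd l = hd u
          · match l, l', u with
            | [], l', u => exact absurd (hd_none d1.symm).symm n1
            | x :: t, [], u => exact absurd d1 (sd_ne_none _)
            | x :: t, y :: t', [] => exact absurd d2 (sd_ne_none _)
            | (i, r) :: t, (j, y) :: t', (k, w) :: u =>
              obtain rfl : i = j := sd_inj.1 d1
              obtain rfl : i = k := sd_inj.1 d2
              exact hrec _ _ _ _ _ _ _ rfl rfl rfl
          · exact med_same_hd _ _ _ _ n1 d1 (Or.inr (Ne.symm d2))
        · by_cases d2 : hd l = hd u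
          · exact (med_same_hd q l u (q, l') n2 d2 (Or.inr (Ne.symm d1))).rot.rot.swap
          · by_cases d3 : hd l' = hd u
            · exact (med_same_hd q l' u (q, l) n3 d3 (Or.inr d1)).rot.rot
            · refine ⟨(q, []), ?_⟩
              rw [dd_nil, dd_nil, dd_nil]
              exact ⟨d1, d2, d3⟩
      · exact med_two _ _ _ _ (fun h => h1 (by rw [h])) (Ne.symm e2)
    · by_cases e2 : q = s
      · subst e2
        exact (med_two q l u (q', l') (fun h => h2 (by rw [h])) (Ne.symm e1)).rot.rot.swap
      · by_cases e3 : q' = s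
        · subst e3
          exact (med_two q' l' u (q, l) (fun h => h3 (by rw [h])) e1).rot.rot
        · rcases lt_or_gt_of_ne e1 with f1 | f1 <;> rcases lt_or_gt_of_ne e2 with f2 | f2 <;>
            rcases lt_or_gt_of_ne e3 with f3 | f3
          · exact med_lt (a := (q, l)) (b := (q', l')) (c := (s, u)) f1 f3
          · exact (med_lt (a := (q, l)) (b := (s, u)) (c := (q', l')) f2 f3).rot.rot.swap
          · exact absurd (f1.trans f3) f2.not_gt
          · exact (med_lt (a := (s, u)) (b := (q, l)) (c := (q', l')) f2 f1).rot
          · exact (med_lt (a := (q', l')) (b := (q, l)) (c := (s, u)) f1 f2).swap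
          · exact absurd (f3.trans f1) f2.not_gt
          · exact (med_lt (a := (q', l')) (b := (s, u)) (c := (q, l)) f3 f2).rot.rot
          · exact (med_lt (a := (s, u)) (b := (q', l')) (c := (q, l)) f3 f1).rot.swap
  induction l with
  | nil =>
    intro q b c h1 h2 h3
    refine red _ _ _ _ h1 h2 h3 ?_
    rintro i r t s t' w u h
    simp at h
  | cons x t ih =>
    intro q b c h1 h2 h3
    refine red _ _ _ _ h1 h2 h3 ?_
    rintro i r t₀ s t' w u h rfl rfl
    obtain ⟨rfl, rfl⟩ := List.cons.inj h
    obtain ⟨⟨p, v⟩, k⟩ := ih r (s, t') (w, u) (by intro h; apply h1; rw [Prod.mk.injEq] at h; rw [h.1, h.2])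
      (by intro h; apply h2; rw [Prod.mk.injEq] at h; rw [h.1, h.2]) (by intro h; apply h3; rw [Prod.mk.injEq] at h; rw [h.1, h.2])
    exact ⟨(q, (i, p) :: v), by rw [dd_cons, dd_cons, dd_cons]; exact k⟩

/-- The model tree structure. -/
def T (m : ℕ) : TreeStr (Dir m) (Br m) where
  δ := dd
  none_iff a b := dd_none a.2 a.1 b.1 b.2
  tree a b p h := dd_tree a.2 a.1 b.1 b.2 p.1 p.2 h
  med a b c h1 h2 h3 := dd_med a.2 a.1 b c h1 h2 h3
  dense a b h := dd_dense a.2 a.1 b.1 b.2 h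
  surj b i := dd_surj b.2 b.1 i

end Model
end WD
namespace WD
namespace Model

variable {m : ℕ}

theorem isAut_of {g : Equiv.Perm (Br m)}
    (h : ∀ a, ∃ σ : Option (Dir m) → Option (Dir m), Function.Injective σ ∧
      ∀ b, dd (g a) (g b) = σ (dd a b)) : (T m).IsAut g := by
  intro a b c
  obtain ⟨σ, hσ, h⟩ := h a
  show dd a b = dd a c ↔ dd (g a) (g b) = dd (g a) (g c)
  rw [h, h, hσ.eq_iff]

/-- Action on the first coordinate. -/
def al (f : Equiv.Perm ℚ) : Equiv.Perm (Br m) := f.prodCongr (Equiv.refl _)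

theorem al_apply (f : Equiv.Perm ℚ) (q : ℚ) (l : List (Fin m × ℚ)) : al f (q, l) = (f q, l) := rfl

theorem al_inv_apply (f : Equiv.Perm ℚ) (q : ℚ) (l : List (Fin m × ℚ)) :
    (al f)⁻¹ (q, l) = (f.symm q, l) := rfl

theorem dd_same (q q' : ℚ) (l l' : List (Fin m × ℚ)) : dd (q, l) (q, l') = dd (q', l) (q', l') := by
  cases l with
  | nil => rw [dd_nil, dd_nil]
  | cons x t =>
    cases l' with
    | nil => rw [dd_cons_nil, dd_cons_nil]
    | cons y t' =>
      obtain ⟨i, r⟩ := x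
      obtain ⟨j, s⟩ := y
      by_cases h : i = j
      · subst h; rw [dd_cons, dd_cons]
      · rw [dd_cons_ne' _ _ _ _ _ h, dd_cons_ne' _ _ _ _ _ h]

theorem isAut_mono {f : Equiv.Perm ℚ} (hf : StrictMono f) : (T m).IsAut (al f) := by
  refine isAut_of fun a => ⟨id, Function.injective_id, fun b => ?_⟩
  obtain ⟨q, l⟩ := a
  obtain ⟨q', l'⟩ := b
  rw [al_apply, al_apply]
  rcases lt_trichotomy q q' with h | rfl | h
  · cases l with
    | nil => rw [dd_gt _ h, dd_gt _ (hf h)]; rfl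
    | cons x t => rw [dd_cons_ne _ _ _ h.ne, dd_cons_ne _ _ _ (hf h).ne]; rfl
  · exact dd_same _ _ _ _
  · rw [dd_lt _ _ h, dd_lt _ _ (hf h)]; rfl

theorem isAut_anti {f : Equiv.Perm ℚ} (hf : StrictAnti f) : (T m).IsAut (al f) := by
  refine isAut_of fun a => ?_
  obtain ⟨q, l⟩ := a
  cases l with
  | nil =>
    refine ⟨Equiv.swap dn up, Equiv.injective _, fun b => ?_⟩
    obtain ⟨q', l'⟩ := b
    rw [al_apply, al_apply]
    rcases lt_trichotomy q q' with h | rfl | h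
    · rw [dd_gt _ h, dd_lt _ _ (hf h), Equiv.swap_apply_right]
    · rw [dd_nil, dd_nil, Equiv.swap_apply_of_ne_of_ne (hd_ne_dn _) (hd_ne_up _)]
    · rw [dd_lt _ _ h, dd_gt _ (hf h), Equiv.swap_apply_left]
  | cons x t =>
    refine ⟨id, Function.injective_id, fun b => ?_⟩
    obtain ⟨q', l'⟩ := b
    rw [al_apply, al_apply]
    by_cases h : q = q'
    · subst h; exact dd_same _ _ _ _
    · rw [dd_cons_ne _ _ _ h, dd_cons_ne _ _ _ (fun h' => h (f.injective h'))]; rfl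

/-- An order isomorphism from the positive rationals to the rationals. -/
def th (x : ℚ) : ℚ := if 1 ≤ x then x - 1 else 1 - x⁻¹

/-- Its inverse. -/
def thi (y : ℚ) : ℚ := if 0 ≤ y then y + 1 else (1 - y)⁻¹

theorem thi_pos (y : ℚ) : 0 < thi y := by
  unfold thi
  split_ifs with h
  · linarith
  · apply inv_pos.2; linarith

theorem th_thi (y : ℚ) : th (thi y) = y := by
  unfold thi
  split_ifs with h
  · unfold th; rw [if_pos (by linarith)]; ring
  · unfold th
    rw [if_neg]
    · rw [inv_inv]; ring
    · push Not
      exact inv_lt_one_of_one_lt₀ (by linarith)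

theorem thi_th {x : ℚ} (hx : 0 < x) : thi (th x) = x := by
  unfold th
  split_ifs with h
  · unfold thi; rw [if_pos (by linarith)]; ring
  · unfold thi
    have : 1 < x⁻¹ := (one_lt_inv₀ hx).2 (by linarith)
    rw [if_neg (by linarith)]
    rw [sub_sub_cancel, inv_inv]

theorem th_lt {x y : ℚ} (hx : 0 < x) (h : x < y) : th x < th y := by
  unfold th
  have hy := hx.trans h
  split_ifs with h1 h2 h2
  · linarith
  · linarith
  · have : 1 < x⁻¹ := (one_lt_inv₀ hx).2 (by linarith)
    linarith
  · have := (inv_lt_inv₀ hy hx).2 h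
    linarith

/-- The involution exchanging the up direction and a side direction at the origin. -/
def sgf (i : Fin m) (a : Br m) : Br m :=
  if 0 < a.1 then (0, (i, th a.1) :: a.2)
  else match a.2 with
    | [] => a
    | x :: t => if a.1 = 0 ∧ x.1 = i then (thi x.2, t) else a

theorem sgf_pos (i : Fin m) {q : ℚ} (l : List (Fin m × ℚ)) (h : 0 < q) :
    sgf i (q, l) = (0, (i, th q) :: l) := by simp [sgf, h]

theorem sgf_side (i : Fin m) (r : ℚ) (t : List (Fin m × ℚ)) :
    sgf i (0, (i, r) :: t) = (thi r, t) := by simp [sgf]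

theorem sgf_neg (i : Fin m) {q : ℚ} (l : List (Fin m × ℚ)) (h : q < 0) :
    sgf i (q, l) = (q, l) := by
  cases l <;> simp [sgf, h.not_gt, h.ne]

theorem sgf_zero (i : Fin m) (l : List (Fin m × ℚ)) (h : hd l ≠ sd i) :
    sgf i (0, l) = (0, l) := by
  cases l with
  | nil => simp [sgf]
  | cons x t =>
    have : x.1 ≠ i := fun h' => h (by simp [hd, h'])
    simp [sgf, this]

/-- Case distinction for `sgf`. -/
theorem sg_cases (i : Fin m) (a : Br m) :
    (∃ q l, 0 < q ∧ a = (q, l)) ∨ (∃ r t, a = (0, (i, r) :: t)) ∨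
    (∃ q l, q < 0 ∧ a = (q, l)) ∨ (∃ l, hd l ≠ sd i ∧ a = (0, l)) := by
  obtain ⟨q, l⟩ := a
  rcases lt_trichotomy q 0 with h | rfl | h
  · right; right; left; exact ⟨q, l, h, rfl⟩
  · by_cases hl : hd l = sd i
    · right; left
      match l with
      | [] => exact absurd hl.symm (sd_ne_none _)
      | (j, r) :: t =>
        obtain rfl : j = i := sd_inj.1 hl
        exact ⟨r, t, rfl⟩
    · right; right; right; exact ⟨l, hl, rfl⟩
  · left; exact ⟨q, l, h, rfl⟩

theorem sgf_invol (i : Fin m) : Function.Involutive (sgf i) := by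
  intro a
  rcases sg_cases i a with ⟨q, l, h, rfl⟩ | ⟨r, t, rfl⟩ | ⟨q, l, h, rfl⟩ | ⟨l, h, rfl⟩
  · rw [sgf_pos _ _ h, sgf_side, thi_th h]
  · rw [sgf_side, sgf_pos _ _ (thi_pos r), th_thi]
  · rw [sgf_neg _ _ h, sgf_neg _ _ h]
  · rw [sgf_zero _ _ h, sgf_zero _ _ h]

/-- The involution as a permutation. -/
def sg (i : Fin m) : Equiv.Perm (Br m) := (sgf_invol i).toPerm

theorem sg_apply (i : Fin m) (a : Br m) : sg i a = sgf i a := rfl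

theorem dd_th {q q' : ℚ} (hq : 0 < q) (hq' : 0 < q') (l l' : List (Fin m × ℚ)) :
    dd (th q, l) (th q', l') = dd (q, l) (q', l') := by
  rcases lt_trichotomy q q' with h | rfl | h
  · have h' := th_lt hq h
    cases l with
    | nil => rw [dd_gt _ h, dd_gt _ h']
    | cons x t => rw [dd_cons_ne _ _ _ h.ne, dd_cons_ne _ _ _ h'.ne]
  · exact dd_same _ _ _ _
  · rw [dd_lt _ _ h, dd_lt _ _ (th_lt hq' h)]

theorem dd_thi (q q' : ℚ) (l l' : List (Fin m × ℚ)) :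
    dd (thi q, l) (thi q', l') = dd (q, l) (q', l') := by
  rw [← dd_th (thi_pos q) (thi_pos q'), th_thi, th_thi]

theorem isAut_sg (i : Fin m) : (T m).IsAut (sg i) := by
  refine isAut_of fun a => ?_
  simp only [sg_apply]
  rcases sg_cases i a with ⟨q, l, h, rfl⟩ | ⟨r, t, rfl⟩ | ⟨q, l, h, rfl⟩ | ⟨l, h, rfl⟩
  · refine ⟨id, Function.injective_id, fun b => ?_⟩
    rw [sgf_pos _ _ h]
    rcases sg_cases i b with ⟨q', l', h', rfl⟩ | ⟨r', t', rfl⟩ | ⟨q', l', h', rfl⟩ | ⟨l', h', rfl⟩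
    · rw [sgf_pos _ _ h', dd_cons, dd_th h h']; rfl
    · rw [sgf_side, dd_cons_ne _ _ _ (thi_pos r').ne, dd_lt _ _ h]; rfl
    · rw [sgf_neg _ _ h', dd_lt _ _ h', dd_lt _ _ (h'.trans h)]; rfl
    · rw [sgf_zero _ _ h', dd_hd_ne _ _ _ _ _ h', dd_lt _ _ h]; rfl
  · refine ⟨id, Function.injective_id, fun b => ?_⟩
    rw [sgf_side]
    rcases sg_cases i b with ⟨q', l', h', rfl⟩ | ⟨r', t', rfl⟩ | ⟨q', l', h', rfl⟩ | ⟨l', h', rfl⟩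
    · rw [sgf_pos _ _ h', dd_lt _ _ (thi_pos r), dd_cons_ne _ _ _ h'.ne]; rfl
    · rw [sgf_side, dd_thi, dd_cons]; rfl
    · rw [sgf_neg _ _ h', dd_lt _ _ h', dd_lt _ _ (h'.trans (thi_pos r))]; rfl
    · rw [sgf_zero _ _ h', dd_hd_ne _ _ _ _ _ h', dd_lt _ _ (thi_pos r)]; rfl
  · refine ⟨id, Function.injective_id, fun b => ?_⟩
    rw [sgf_neg _ _ h]
    have key : ∀ (s s' : ℚ) (u u' : List (Fin m × ℚ)), q < s → q < s' →
        dd (q, l) (s, u) = dd (q, l) (s', u') := by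
      intro s s' u u' hs hs'
      cases l with
      | nil => rw [dd_gt _ hs, dd_gt _ hs']
      | cons x t => rw [dd_cons_ne _ _ _ hs.ne, dd_cons_ne _ _ _ hs'.ne]
    rcases sg_cases i b with ⟨q', l', h', rfl⟩ | ⟨r', t', rfl⟩ | ⟨q', l', h', rfl⟩ | ⟨l', h', rfl⟩
    · rw [sgf_pos _ _ h']; exact key _ _ _ _ h (h.trans h')
    · rw [sgf_side]; exact key _ _ _ _ (h.trans (thi_pos r')) h
    · rw [sgf_neg _ _ h']; rfl
    · rw [sgf_zero _ _ h']; rfl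
  · cases l with
    | nil =>
      refine ⟨Equiv.swap up (sd i), Equiv.injective _, fun b => ?_⟩
      rw [sgf_zero _ _ h]
      rcases sg_cases i b with ⟨q', l', h', rfl⟩ | ⟨r', t', rfl⟩ | ⟨q', l', h', rfl⟩ | ⟨l', h', rfl⟩
      · rw [sgf_pos _ _ h', dd_nil, dd_gt _ h', Equiv.swap_apply_left]; rfl
      · rw [sgf_side, dd_nil, dd_gt _ (thi_pos r')]; exact (Equiv.swap_apply_right _ _).symm
      · rw [sgf_neg _ _ h', dd_lt _ _ h', Equiv.swap_apply_of_ne_of_ne dn_ne_up (dn_ne_sd _)]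
      · rw [sgf_zero _ _ h', dd_nil, Equiv.swap_apply_of_ne_of_ne (hd_ne_up _) h']
    | cons x t =>
      refine ⟨id, Function.injective_id, fun b => ?_⟩
      rw [sgf_zero _ _ h]
      obtain ⟨j, s⟩ := x
      have hji : j ≠ i := fun h' => h (by rw [h']; rfl)
      rcases sg_cases i b with ⟨q', l', h', rfl⟩ | ⟨r', t', rfl⟩ | ⟨q', l', h', rfl⟩ | ⟨l', h', rfl⟩
      · rw [sgf_pos _ _ h', dd_cons_ne' _ _ _ _ _ hji, dd_cons_ne _ _ _ h'.ne]; rfl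
      · rw [sgf_side, dd_cons_ne _ _ _ (thi_pos r').ne, dd_cons_ne' _ _ _ _ _ hji]; rfl
      · rw [sgf_neg _ _ h']; rfl
      · rw [sgf_zero _ _ h']; rfl

/-- Piecewise projective map. -/
def vf (x : ℚ) : ℚ :=
  if x ≤ 0 then x else if 2 * x ≤ 1 then x / (1 - x) else if x ≤ 1 then 3 - 1 / x else x + 1

/-- Its inverse. -/
def vi (y : ℚ) : ℚ :=
  if y ≤ 0 then y else if y ≤ 1 then y / (1 + y) else if y ≤ 2 then 1 / (3 - y) else y - 1

theorem vi_vf (x : ℚ) : vi (vf x) = x := by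
  unfold vf
  split_ifs with h1 h2 h3
  · simp [vi, h1]
  · push Not at h1
    have h4 : 0 < 1 - x := by linarith
    have h5 : 0 < x / (1 - x) := div_pos h1 h4
    have h6 : x / (1 - x) ≤ 1 := by rw [div_le_one h4]; linarith
    unfold vi
    rw [if_neg h5.not_ge, if_pos h6]
    field_simp
    ring
  · push Not at h1 h2
    have h4 : 1 / x < 2 := by rw [div_lt_iff₀ h1]; linarith
    have h5 : 1 ≤ 1 / x := by rw [le_div_iff₀ h1]; linarith
    unfold vi
    rw [if_neg (by linarith), if_neg (by linarith), if_pos (by linarith)]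
    rw [sub_sub_cancel, one_div_one_div]
  · push Not at h3
    unfold vi
    rw [if_neg (by linarith), if_neg (by linarith), if_neg (by linarith)]
    ring

theorem vf_vi (y : ℚ) : vf (vi y) = y := by
  unfold vi
  split_ifs with h1 h2 h3
  · simp [vf, h1]
  · push Not at h1
    have h4 : 0 < 1 + y := by linarith
    have h5 : 0 < y / (1 + y) := div_pos h1 h4
    have h6 : 2 * (y / (1 + y)) ≤ 1 := by
      rw [← mul_div_assoc, div_le_one h4]; linarith
    unfold vf
    rw [if_neg h5.not_ge, if_pos h6]
    have : 1 - y / (1 + y) = 1 / (1 + y) := by field_simp; ring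
    rw [this]
    field_simp
  · push Not at h1 h2
    have h4 : 0 < 3 - y := by linarith
    have h5 : 1 / (3 - y) ≤ 1 := by rw [div_le_one h4]; linarith
    have h6 : 1 / 2 < 1 / (3 - y) := by
      rw [div_lt_div_iff₀ (by norm_num) h4]; linarith
    unfold vf
    rw [if_neg (by linarith), if_neg (by linarith), if_pos h5]
    rw [one_div_one_div]; ring
  · push Not at h3
    unfold vf
    rw [if_neg (by linarith), if_neg (by linarith), if_neg (by linarith)]
    ring

theorem vf_lt {x y : ℚ} (h : x < y) : vf x < vf y := by
  -- bounds on each piece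
  have b2 : ∀ z : ℚ, 0 < z → 2 * z ≤ 1 → 0 < z / (1 - z) ∧ z / (1 - z) ≤ 1 := by
    intro z h1 h2
    have h4 : 0 < 1 - z := by linarith
    exact ⟨div_pos h1 h4, by rw [div_le_one h4]; linarith⟩
  have b3 : ∀ z : ℚ, 1 < 2 * z → z ≤ 1 → 1 / z < 2 ∧ 1 ≤ 1 / z := by
    intro z h1 h2
    have h4 : 0 < z := by linarith
    exact ⟨by rw [div_lt_iff₀ h4]; linarith, by rw [le_div_iff₀ h4]; linarith⟩
  unfold vf
  split_ifs with x1 y1 y2 y3 x2 y1 y2 y3 x3 y1 y2 y3 y1 y2 y3 <;> try push Not at *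
  all_goals try linarith
  · linarith [(b2 y (by linarith) (by linarith)).1]
  · linarith [(b3 y (by linarith) (by linarith)).1]
  · rw [div_lt_div_iff₀ (by linarith) (by linarith)]; nlinarith
  · linarith [(b2 x (by linarith) (by linarith)).2, (b3 y (by linarith) (by linarith)).1]
  · linarith [(b2 x (by linarith) (by linarith)).2]
  · have : 1 / y < 1 / x := one_div_lt_one_div_of_lt (by linarith) h
    linarith
  · linarith [(b3 x (by linarith) (by linarith)).2]

/-- The map as a permutation. -/
def vP : Equiv.Perm ℚ := ⟨vf, vi, vi_vf, vf_vi⟩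

theorem vP_mono : StrictMono vP := fun _ _ h => vf_lt h

/-- Generators. -/
def gens (m : ℕ) : Set (Equiv.Perm (Br m)) :=
  {al (Equiv.addRight (1 : ℚ)), al (Equiv.neg ℚ), al vP} ∪ Set.range sg

theorem gens_finite (m : ℕ) : (gens m).Finite :=
  Set.Finite.union (by simp) (Set.finite_range _)

theorem gens_aut : ∀ g ∈ gens m, (T m).IsAut g := by
  rintro g ((rfl | rfl | rfl) | ⟨i, rfl⟩)
  · exact isAut_mono (fun a b h => by simpa using h)
  · exact isAut_anti (fun a b h => by simpa using h)
  · exact isAut_mono vP_mono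
  · exact isAut_sg i

/-- The group. -/
abbrev Ga (m : ℕ) : Subgroup (Equiv.Perm (Br m)) := Subgroup.closure (gens m)

/-- translation -/
def tr : Equiv.Perm (Br m) := al (Equiv.addRight (1 : ℚ))
/-- flip -/
def fl : Equiv.Perm (Br m) := al (Equiv.neg ℚ)

theorem tr_mem : (tr : Equiv.Perm (Br m)) ∈ Ga m :=
  Subgroup.subset_closure (Or.inl (Or.inl rfl))
theorem fl_mem : (fl : Equiv.Perm (Br m)) ∈ Ga m :=
  Subgroup.subset_closure (Or.inl (Or.inr (Or.inl rfl)))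
theorem v_mem : (al vP : Equiv.Perm (Br m)) ∈ Ga m :=
  Subgroup.subset_closure (Or.inl (Or.inr (Or.inr rfl)))
theorem sg_mem (i : Fin m) : sg i ∈ Ga m :=
  Subgroup.subset_closure (Or.inr ⟨i, rfl⟩)

theorem tr_apply (q : ℚ) (l : List (Fin m × ℚ)) : tr (q, l) = (q + 1, l) := rfl
theorem tr_inv_apply (q : ℚ) (l : List (Fin m × ℚ)) : tr⁻¹ (q, l) = (q - 1, l) := by
  show (q + -1, l) = (q - 1, l)
  rw [sub_eq_add_neg]
theorem fl_apply (q : ℚ) (l : List (Fin m × ℚ)) : fl (q, l) = (-q, l) := rfl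

/-- Elements supported on the upper half. -/
def Hp (m : ℕ) : Subgroup (Equiv.Perm (Br m)) where
  carrier := {g | g ∈ Ga m ∧ ∀ q l, q ≤ 0 → g (q, l) = (q, l)}
  mul_mem' := by
    rintro f g ⟨hf, hf'⟩ ⟨hg, hg'⟩
    refine ⟨mul_mem hf hg, fun q l h => ?_⟩
    show f (g (q, l)) = _
    rw [hg' q l h, hf' q l h]
  one_mem' := ⟨one_mem _, fun _ _ _ => rfl⟩
  inv_mem' := by
    rintro f ⟨hf, hf'⟩
    refine ⟨inv_mem hf, fun q l h => ?_⟩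
    show f.symm (q, l) = _
    rw [Equiv.symm_apply_eq, hf' q l h]

theorem vf_nonpos {x : ℚ} (h : x ≤ 0) : vf x = x := by simp [vf, h]

theorem v_Hp : (al vP : Equiv.Perm (Br m)) ∈ Hp m :=
  ⟨v_mem, fun q l h => by rw [al_apply]; exact congrArg (·, l) (vf_nonpos h)⟩

theorem w_Hp : (tr * al vP * tr⁻¹ : Equiv.Perm (Br m)) ∈ Hp m := by
  refine ⟨mul_mem (mul_mem tr_mem v_mem) (inv_mem tr_mem), fun q l h => ?_⟩
  show tr (al vP (tr⁻¹ (q, l))) = _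
  rw [tr_inv_apply, al_apply, tr_apply]
  show (vf (q - 1) + 1, l) = _
  rw [vf_nonpos (by linarith)]
  simp

theorem w_apply (q : ℚ) (l : List (Fin m × ℚ)) :
    (tr * al vP * tr⁻¹ : Equiv.Perm (Br m)) (q, l) = (vf (q - 1) + 1, l) := by
  show tr (al vP (tr⁻¹ (q, l))) = _
  rw [tr_inv_apply, al_apply, tr_apply]; rfl

theorem s_Hp (i : Fin m) : (tr * sg i * tr⁻¹ : Equiv.Perm (Br m)) ∈ Hp m := by
  refine ⟨mul_mem (mul_mem tr_mem (sg_mem i)) (inv_mem tr_mem), fun q l h => ?_⟩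
  show tr (sg i (tr⁻¹ (q, l))) = _
  rw [tr_inv_apply, sg_apply, sgf_neg _ _ (by linarith), tr_apply]
  simp

theorem s_apply (i : Fin m) (r : ℚ) (l : List (Fin m × ℚ)) :
    (tr * sg i * tr⁻¹ : Equiv.Perm (Br m)) (1, (i, r) :: l) = (thi r + 1, l) := by
  show tr (sg i (tr⁻¹ (1, (i, r) :: l))) = _
  rw [tr_inv_apply, sg_apply, sub_self, sgf_side, tr_apply]

/-- One step of the Euclidean algorithm. -/
theorem vf_frac {p q : ℕ} (hp : 0 < p) (hpq : p < q) :
    ∃ p' q' : ℕ, 0 < p' ∧ 0 < q' ∧ q' < q ∧ vf ((p : ℚ) / q) = (p' : ℚ) / q' := by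
  have hp0 : (0 : ℚ) < p := by exact_mod_cast hp
  have hq0 : (0 : ℚ) < q := by exact_mod_cast hp.trans hpq
  have hlt : (p : ℚ) < q := by exact_mod_cast hpq
  by_cases h : 2 * p ≤ q
  · refine ⟨p, q - p, hp, by omega, by omega, ?_⟩
    have h' : (2 : ℚ) * p ≤ q := by exact_mod_cast h
    unfold vf
    rw [if_neg (div_pos hp0 hq0).not_ge, if_pos (by rw [← mul_div_assoc, div_le_one hq0]; exact h')]
    rw [Nat.cast_sub hpq.le]
    have : (q : ℚ) - p ≠ 0 := by linarith
    have h3 : 1 - (p : ℚ) / q = (q - p) / q := by field_simp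
    rw [h3]
    field_simp
  · push Not at h
    refine ⟨3 * p - q, p, by omega, hp, hpq, ?_⟩
    have h' : (q : ℚ) < 2 * p := by exact_mod_cast h
    unfold vf
    rw [if_neg (div_pos hp0 hq0).not_ge,
      if_neg (by rw [← mul_div_assoc, div_le_one hq0]; exact h'.not_ge),
      if_pos (by rw [div_le_one hq0]; exact hlt.le)]
    rw [Nat.cast_sub (by omega)]
    push_cast
    field_simp

theorem to_one_aux (q : ℕ) : 0 < q → ∀ p : ℕ, 0 < p → ∃ g ∈ Hp m, ∀ l, g ((p : ℚ) / q, l) = (1, l) := by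
  induction q using Nat.strong_induction_on with
  | _ q ihq =>
    intro hq p
    have hq0 : (0 : ℚ) < q := by exact_mod_cast hq
    induction p using Nat.strong_induction_on with
    | _ p ihp =>
      intro hp
      have hp0 : (0 : ℚ) < p := by exact_mod_cast hp
      rcases lt_trichotomy p q with h | h | h
      · obtain ⟨p', q', h1, h2, h3, h4⟩ := vf_frac hp h
        obtain ⟨g, hg, hgl⟩ := ihq q' h3 h2 p' h1
        refine ⟨g * al vP, mul_mem hg v_Hp, fun l => ?_⟩
        show g (vf ((p : ℚ) / q), l) = _
        rw [h4, hgl]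
      · subst h
        exact ⟨1, one_mem _, fun l => by rw [div_self hp0.ne']; rfl⟩
      · have hlt : (q : ℚ) < p := by exact_mod_cast h
        by_cases h2 : 2 * q ≤ p
        · obtain ⟨g, hg, hgl⟩ := ihp (p - q) (by omega) (by omega)
          refine ⟨g * (al vP)⁻¹, mul_mem hg (inv_mem v_Hp), fun l => ?_⟩
          show g ((al vP)⁻¹ ((p : ℚ) / q, l)) = _
          have : (al vP)⁻¹ ((p : ℚ) / q, l) = (((p - q : ℕ) : ℚ) / q, l) := by
            show (al vP).symm ((p : ℚ) / q, l) = _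
            rw [Equiv.symm_apply_eq, al_apply]
            have h5 : (1 : ℚ) ≤ ((p - q : ℕ) : ℚ) / q := by
              rw [le_div_iff₀ hq0, one_mul]
              exact_mod_cast (by omega : q ≤ p - q)
            have hsum : ((p - q : ℕ) : ℚ) / q + 1 = (p : ℚ) / q := by
              rw [Nat.cast_sub h.le]; field_simp; ring
            have h6 : vf (((p - q : ℕ) : ℚ) / q) = (p : ℚ) / q := by
              rcases h5.eq_or_lt with h5 | h5
              · rw [← hsum, ← h5]; norm_num [vf]
              · unfold vf
                rw [if_neg (by linarith), if_neg (by linarith), if_neg (by linarith), hsum]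
            exact congrArg (·, l) h6.symm
          rw [this, hgl]
        · obtain ⟨p', q', h1, h2, h3, h4⟩ := vf_frac (p := p - q) (q := q) (by omega) (by omega)
          obtain ⟨g, hg, hgl⟩ := ihq q' h3 h2 (p' + q') (by omega)
          refine ⟨g * (tr * al vP * tr⁻¹), mul_mem hg w_Hp, fun l => ?_⟩
          show g ((tr * al vP * tr⁻¹ : Equiv.Perm (Br m)) ((p : ℚ) / q, l)) = _
          rw [w_apply]
          have h5 : (p : ℚ) / q - 1 = ((p - q : ℕ) : ℚ) / q := by
            rw [Nat.cast_sub h.le]; field_simp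
          have hq' : (0 : ℚ) < q' := by exact_mod_cast h2
          have h6 : (p' : ℚ) / q' + 1 = ((p' + q' : ℕ) : ℚ) / q' := by
            push_cast; field_simp
          rw [h5, h4, h6, hgl]

theorem to_one {x : ℚ} (hx : 0 < x) : ∃ g ∈ Hp m, ∀ l, g (x, l) = (1, l) := by
  obtain ⟨g, hg, h⟩ := to_one_aux (m := m) x.den x.den_pos x.num.toNat (by
    have := Rat.num_pos.2 hx; omega)
  refine ⟨g, hg, fun l => ?_⟩
  have h1 : ((x.num.toNat : ℕ) : ℚ) = (x.num : ℚ) := by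
    have := Rat.num_pos.2 hx
    exact_mod_cast Int.toNat_of_nonneg this.le
  have := h l
  rwa [h1, Rat.num_div_den] at this

theorem to_base (l : List (Fin m × ℚ)) : ∀ x : ℚ, 0 < x → ∃ g ∈ Hp m, g (x, l) = (1, []) := by
  induction l with
  | nil =>
    intro x hx
    obtain ⟨g, hg, h⟩ := to_one (m := m) hx
    exact ⟨g, hg, h []⟩
  | cons y t ih =>
    intro x hx
    obtain ⟨i, r⟩ := y
    obtain ⟨g, hg, h⟩ := to_one (m := m) hx
    obtain ⟨k, hk, hk'⟩ := ih (thi r + 1) (by linarith [thi_pos r])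
    refine ⟨k * (tr * sg i * tr⁻¹) * g, mul_mem (mul_mem hk (s_Hp i)) hg, ?_⟩
    show k ((tr * sg i * tr⁻¹ : Equiv.Perm (Br m)) (g (x, (i, r) :: t))) = _
    rw [h, s_apply, hk']

theorem up_iff (a : Br m) : dd (0, []) a = up ↔ 0 < a.1 := by
  obtain ⟨q, l⟩ := a
  rcases lt_trichotomy q 0 with h | rfl | h
  · rw [dd_lt _ _ h]; simp [dn_ne_up, h.not_gt]
  · rw [dd_nil]; simp [hd_ne_up]
  · rw [dd_gt _ h]; simp [h]

theorem Hp_trans {x y : Br m} (hx : dd (0, []) x = up) (hy : dd (0, []) y = up) :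
    ∃ h ∈ Ga m, h x = y ∧ ∀ r, dd (0, []) r ≠ up → h r = r := by
  rw [up_iff] at hx hy
  obtain ⟨g, hg, hgx⟩ := to_base x.2 x.1 hx
  obtain ⟨k, hk, hky⟩ := to_base y.2 y.1 hy
  have hmem := mul_mem (inv_mem hk) hg
  refine ⟨k⁻¹ * g, hmem.1, ?_, fun r hr => ?_⟩
  · show k.symm (g x) = y
    rw [Equiv.symm_apply_eq]
    exact hgx.trans hky.symm
  · rw [Ne, up_iff] at hr
    exact hmem.2 r.1 r.2 (not_lt.1 hr)

theorem swap_up {d : Option (Dir m)} (hd0 : d ≠ none) : ∃ s ∈ Ga m, (∀ x, s (s x) = x) ∧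
    (∀ x, dd (0, []) x = d → dd (0, []) (s x) = up) ∧
    (∀ x, dd (0, []) x = up → dd (0, []) (s x) = d) ∧
    (∀ x, dd (0, []) x ≠ d → dd (0, []) x ≠ up → s x = x) := by
  match d with
  | none => exact absurd rfl hd0
  | some (Sum.inl true) => exact ⟨1, one_mem _, fun _ => rfl, fun _ h => h, fun _ h => h, fun _ _ _ => rfl⟩
  | some (Sum.inl false) =>
    have dn_iff : ∀ a : Br m, dd (0, []) a = dn ↔ a.1 < 0 := by
      rintro ⟨q, l⟩
      rcases lt_trichotomy q 0 with h | rfl | h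
      · rw [dd_lt _ _ h]; simp [h]
      · rw [dd_nil]; simp [hd_ne_dn]
      · rw [dd_gt _ h]; simp [dn_ne_up.symm, h.not_gt]
    refine ⟨fl, fl_mem, ?_, ?_, ?_, ?_⟩
    · rintro ⟨q, l⟩; rw [fl_apply, fl_apply, neg_neg]
    · rintro ⟨q, l⟩ h
      have h := (dn_iff _).1 h
      rw [up_iff, fl_apply]
      simpa using h
    · rintro ⟨q, l⟩ h
      have h := (up_iff _).1 h
      refine (dn_iff _).2 ?_
      rw [fl_apply]
      simpa using h
    · rintro ⟨q, l⟩ h h'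
      have h1 : ¬ q < 0 := fun hq => h ((dn_iff (q, l)).2 hq)
      have h2 : ¬ 0 < q := fun hq => h' ((up_iff (q, l)).2 hq)
      obtain rfl : q = 0 := le_antisymm (not_lt.1 h2) (not_lt.1 h1)
      rw [fl_apply, neg_zero]
  | some (Sum.inr i) =>
    refine ⟨sg i, sg_mem i, sgf_invol i, ?_, ?_, ?_⟩
    · intro x hx
      have hx : dd (0, []) x = sd i := hx
      rw [sg_apply]
      rcases sg_cases i x with ⟨q, l, h, rfl⟩ | ⟨r, t, rfl⟩ | ⟨q, l, h, rfl⟩ | ⟨l, h, rfl⟩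
      · rw [dd_gt _ h] at hx; exact absurd hx (up_ne_sd _)
      · rw [sgf_side, dd_gt _ (thi_pos r)]
      · rw [dd_lt _ _ h] at hx; exact absurd hx (dn_ne_sd _)
      · rw [dd_nil] at hx; exact absurd hx h
    · rintro ⟨q, l⟩ hx
      rw [up_iff] at hx
      rw [sg_apply, sgf_pos _ _ hx, dd_nil]; rfl
    · intro x hx hx'
      have hx : dd (0, []) x ≠ sd i := hx
      rw [sg_apply]
      rcases sg_cases i x with ⟨q, l, h, rfl⟩ | ⟨r, t, rfl⟩ | ⟨q, l, h, rfl⟩ | ⟨l, h, rfl⟩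
      · rw [dd_gt _ h] at hx'; exact absurd rfl hx'
      · rw [dd_nil] at hx; exact absurd rfl hx
      · exact sgf_neg _ _ h
      · exact sgf_zero _ _ h

theorem hA_base (p p' : Br m) (hp : p ≠ (0, [])) (hp' : p' ≠ (0, [])) :
    ∃ g ∈ Ga m, g p = p' ∧
      ∀ r, dd (0, []) r ≠ dd (0, []) p → dd (0, []) r ≠ dd (0, []) p' → g r = r := by
  have hd1 : dd (0, []) p ≠ none := fun h => hp ((dd_none [] 0 p.1 p.2).1 h).symm
  have hd2 : dd (0, []) p' ≠ none := fun h => hp' ((dd_none [] 0 p'.1 p'.2).1 h).symm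
  obtain ⟨s, hs, sinv, sdu, sud, sfix⟩ := swap_up hd1
  obtain ⟨s', hs', sinv', sdu', sud', sfix'⟩ := swap_up hd2
  obtain ⟨h, hh, hhp, hfix⟩ := Hp_trans (sdu p rfl) (sdu' p' rfl)
  by_cases e : dd (0, []) p = dd (0, []) p'
  · -- same direction
    obtain ⟨h, hh, hhp, hfix⟩ := Hp_trans (sdu p rfl) (sdu p' e.symm)
    refine ⟨s * h * s, mul_mem (mul_mem hs hh) hs, ?_, fun r hr _ => ?_⟩
    · show s (h (s p)) = p'
      rw [hhp, sinv]
    · show s (h (s r)) = r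
      rw [hfix, sinv]
      intro hu
      apply hr
      have := sud _ hu
      rwa [sinv] at this
  · by_cases e1 : dd (0, []) p = up
    · refine ⟨s' * h * s, mul_mem (mul_mem hs' hh) hs, ?_, fun r hr hr' => ?_⟩
      · show s' (h (s p)) = p'
        rw [hhp, sinv']
      · show s' (h (s r)) = r
        have hru : dd (0, []) r ≠ up := by rwa [e1] at hr
        rw [sfix r hr hru, hfix r hru, sfix' r hr' hru]
    · by_cases e2 : dd (0, []) p' = up
      · refine ⟨s' * h * s, mul_mem (mul_mem hs' hh) hs, ?_, fun r hr hr' => ?_⟩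
        · show s' (h (s p)) = p'
          rw [hhp, sinv']
        · show s' (h (s r)) = r
          have hru : dd (0, []) r ≠ up := by rwa [e2] at hr'
          rw [sfix r hr hru, hfix r hru, sfix' r hr' hru]
      · refine ⟨s * s' * h * s, mul_mem (mul_mem (mul_mem hs hs') hh) hs, ?_, fun r hr hr' => ?_⟩
        · show s (s' (h (s p))) = p'
          rw [hhp, sinv', sfix p' (Ne.symm e) e2]
        · show s (s' (h (s r))) = r
          by_cases hru : dd (0, []) r = up
          · have h1 := sud r hru
            rw [hfix _ (by rw [h1]; exact e1), sfix' _ (by rw [h1]; exact e) (by rw [h1]; exact e1),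
              sinv]
          · rw [sfix r hr hru, hfix r hru, sfix' r hr' hru, sfix r hr hru]

theorem to_origin (a : Br m) : ∃ g ∈ Ga m, g a = (0, []) := by
  obtain ⟨k, hk, hka⟩ : ∃ k ∈ Ga m, 0 < (k a).1 := by
    obtain ⟨q, l⟩ := a
    rcases lt_trichotomy q 0 with h | rfl | h
    · exact ⟨fl, fl_mem, by rw [fl_apply]; simpa using h⟩
    · exact ⟨tr, tr_mem, by rw [tr_apply]; simp⟩
    · exact ⟨1, one_mem _, h⟩
  obtain ⟨g, hg, h⟩ := to_base (k a).2 (k a).1 hka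
  refine ⟨tr⁻¹ * g * k, mul_mem (mul_mem (inv_mem tr_mem) hg.1) hk, ?_⟩
  show tr⁻¹ (g (k a)) = _
  have h : g (k a) = (1, []) := h
  rw [h, tr_inv_apply, sub_self]

theorem Ga_trans (a b : Br m) : ∃ g ∈ Ga m, g a = b := by
  obtain ⟨g, hg, h⟩ := to_origin a
  obtain ⟨k, hk, h'⟩ := to_origin b
  refine ⟨k⁻¹ * g, mul_mem (inv_mem hk) hg, ?_⟩
  show k.symm (g a) = b
  rw [Equiv.symm_apply_eq, h, h']

theorem hA (b p p' : Br m) (hp : p ≠ b) (hp' : p' ≠ b) : ∃ g ∈ Ga m, g p = p' ∧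
    ∀ r, (T m).δ b r ≠ (T m).δ b p → (T m).δ b r ≠ (T m).δ b p' → g r = r := by
  obtain ⟨k, hk, hkb⟩ := to_origin b
  have haut : (T m).IsAut k := (Subgroup.closure_le (T m).autGroup).2 gens_aut hk
  obtain ⟨g, hg, hgp, hfix⟩ := hA_base (k p) (k p') (fun h => hp (k.injective (h.trans hkb.symm)))
    (fun h => hp' (k.injective (h.trans hkb.symm)))
  refine ⟨k⁻¹ * g * k, mul_mem (mul_mem (inv_mem hk) hg) hk, ?_, fun r hr hr' => ?_⟩
  · show k.symm (g (k p)) = p'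
    rw [Equiv.symm_apply_eq, hgp]
  · show k.symm (g (k r)) = r
    rw [Equiv.symm_apply_eq]
    apply hfix
    · intro h
      apply hr
      rw [haut b r p, hkb]; exact h
    · intro h
      apply hr'
      rw [haut b r p', hkb]; exact h

end Model
end WD

theorem statement7 (n : ℕ) (hn : 3 ≤ n) :
    ∃ (X : Type) (_ : TopologicalSpace X) (_ : IsWazewskiDendrite n X)
      (G : Subgroup (X ≃ₜ X)),
      G.FG ∧ Dense (G : Set (X ≃ₜ X)) ∧
      ∀ F₁ F₂ : Set X, F₁.Finite → F₂.Finite →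
        (∀ p ∈ F₁, ptOrder X p = n) → (∀ p ∈ F₂, ptOrder X p = n) →
        ∀ ψ : dendriteHull X F₁ ≃ₜ dendriteHull X F₂,
          Subtype.val '' (⇑ψ '' (Subtype.val ⁻¹' F₁)) = F₂ →
          ∃ g ∈ G, ∀ (p : X) (hp : p ∈ F₁),
            (g : X ≃ₜ X) p = (ψ ⟨p, subset_dendriteHull hp⟩ : X) := by
  obtain ⟨m, rfl⟩ : ∃ m, n = m + 2 := ⟨n - 2, by omega⟩
  have hc : Fintype.card (WD.Dir m) = m + 2 := by
    simp [WD.Dir, add_comm]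
  have h := (WD.Model.T m).final (by rw [hc]; exact hn) (WD.Model.gens m)
    (WD.Model.gens_finite m) WD.Model.gens_aut WD.Model.Ga_trans WD.Model.hA
  rw [hc] at h
  exact h
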